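/- arXiv:1709.08262 — 3 statements merged into one kernel-verified Lean document; each statement's English description precedes it below -/
import Mathlib

section
/- For every dimension n ≥ 1 there exists a measurable set E ⊂ R^n with infinite perimeter, P(E) = ∞, such that liminf_{ε→0⁺} (1/|log ε|) ‖γ_ε ∗ 1_E‖_{H^{1/2}}^2 = 0. -/
open MeasureTheory Filter Topology Real
open scoped FourierTransform RealInnerProductSpace ENNReal

noncomputable section

variable {V : Type*} [NormedAddCommGroup V] [InnerProductSpace ℝ V]
  [FiniteDimensional ℝ V] [MeasurableSpace V] [BorelSpace V] [MeasureSpace V]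

/-- convolution of two real-valued functions -/
def conv (f g : V → ℝ) (x : V) : ℝ := ∫ y, f y * g (x - y)

/-- the standard Gaussian `γ(x) = (2π)^{-n/2} exp(-|x|²/2)` -/
def gauss (x : V) : ℝ :=
  (2 * π) ^ (-(Module.finrank ℝ V : ℝ) / 2) * Real.exp (-‖x‖ ^ 2 / 2)

/-- the scaled function `f_r(x) = r^{-n} f(x/r)` -/
def scaleFn (f : V → ℝ) (r : ℝ) (x : V) : ℝ := r⁻¹ ^ (Module.finrank ℝ V) * f (r⁻¹ • x)

/-- the scaled Gaussian `γ_ε` -/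
def gaussSc (ε : ℝ) (x : V) : ℝ := scaleFn gauss ε x

/-- the squared `H^{1/2}` seminorm `∫ |ξ| |û(ξ)|² dξ` (extended-real valued) -/
def H12e (u : V → ℝ) : ℝ≥0∞ :=
  ∫⁻ ξ, (‖ξ‖₊ : ℝ≥0∞) * (‖𝓕 (fun x => (u x : ℂ)) ξ‖₊ : ℝ≥0∞) ^ 2

/-- divergence of a vector field on ℝⁿ -/
def divg {n : ℕ} (φ : EuclideanSpace ℝ (Fin n) → EuclideanSpace ℝ (Fin n))
    (x : EuclideanSpace ℝ (Fin n)) : ℝ :=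
  ∑ i, fderiv ℝ φ x (EuclideanSpace.single i 1) i

/-- perimeter of a set: `P(E) = sup { ∫_E div φ : φ ∈ C_c¹, ‖φ‖ ≤ 1 }` -/
def perim {n : ℕ} (E : Set (EuclideanSpace ℝ (Fin n))) : ℝ≥0∞ :=
  ⨆ (φ : EuclideanSpace ℝ (Fin n) → EuclideanSpace ℝ (Fin n))
    (_ : ContDiff ℝ 1 φ) (_ : HasCompactSupport φ) (_ : ∀ x, ‖φ x‖ ≤ 1),
    ENNReal.ofReal (∫ x in E, divg φ x)


set_option linter.overlappingInstances false
set_option linter.style.haveILetI false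

abbrev EE (n : ℕ) := EuclideanSpace ℝ (Fin n)

/-- weak-star compact model of `{f : 0 ≤ f ≤ 1}` -/
def KW {n : ℕ} (μ : Measure (EE n)) [IsFiniteMeasure μ] : Set (WeakDual ℝ (Lp ℝ 2 μ)) :=
  {φ | ‖WeakDual.toStrongDual φ‖ ≤ ‖(indicatorConstLp 2 MeasurableSet.univ (measure_ne_top μ _) (1:ℝ) : Lp ℝ 2 μ)‖} ∩
  {φ | ∀ s (hs : MeasurableSet s), 0 ≤ φ (indicatorConstLp 2 hs (measure_ne_top μ s) (1 : ℝ)) ∧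
    φ (indicatorConstLp 2 hs (measure_ne_top μ s) (1 : ℝ)) ≤ μ.real s}

lemma KW_compact {n : ℕ} (μ : Measure (EE n)) [IsFiniteMeasure μ] : IsCompact (KW μ) := by
  have h1 := WeakDual.isCompact_closedBall (𝕜 := ℝ) (E := Lp ℝ 2 μ) 0
    ‖(indicatorConstLp 2 MeasurableSet.univ (measure_ne_top μ _) (1:ℝ) : Lp ℝ 2 μ)‖
  have h2 : IsClosed {φ : WeakDual ℝ (Lp ℝ 2 μ) | ∀ s (hs : MeasurableSet s), 0 ≤ φ (indicatorConstLp 2 hs (measure_ne_top μ s) (1 : ℝ)) ∧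
    φ (indicatorConstLp 2 hs (measure_ne_top μ s) (1 : ℝ)) ≤ μ.real s} := by
    simp only [Set.ofPred_forall]
    refine isClosed_iInter fun s => isClosed_iInter fun hs => ?_
    refine IsClosed.and ?_ ?_
    · exact isClosed_le continuous_const (WeakDual.eval_continuous _)
    · exact isClosed_le (WeakDual.eval_continuous _) continuous_const
  have := h1.inter_right h2
  convert this using 1
  ext φ
  simp [KW]

lemma KW_rep {n : ℕ} (μ : Measure (EE n)) [IsFiniteMeasure μ] (φ : WeakDual ℝ (Lp ℝ 2 μ))
    (hφ : φ ∈ KW μ) : ∃ f : EE n → ℝ, Measurable f ∧ (∀ x, f x ∈ Set.Icc (0:ℝ) 1) ∧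
      ∀ g : Lp ℝ 2 μ, φ g = ∫ x, f x * g x ∂μ := by
  set F : Lp ℝ 2 μ := (InnerProductSpace.toDual ℝ (Lp ℝ 2 μ)).symm (WeakDual.toStrongDual φ) with hF
  have hFφ : ∀ g, φ g = ⟪F, g⟫ := by
    intro g
    rw [hF, InnerProductSpace.toDual_symm_apply]; rfl
  have hFi : Integrable F μ := (Lp.memLp F).integrable (by norm_num)
  have h0 : 0 ≤ᵐ[μ] F := by
    refine ae_nonneg_of_forall_setIntegral_nonneg hFi fun s hs _ => ?_
    have := (hφ.2 s hs).1
    rwa [hFφ, real_inner_comm, L2.inner_indicatorConstLp_one] at this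
  have h1 : F ≤ᵐ[μ] fun _ => (1:ℝ) := by
    refine ae_le_of_forall_setIntegral_le hFi (integrable_const _) fun s hs _ => ?_
    have := (hφ.2 s hs).2
    rw [hFφ, real_inner_comm, L2.inner_indicatorConstLp_one] at this
    simpa using this
  obtain ⟨f0, hf0m, hf0⟩ := (Lp.aestronglyMeasurable F).aemeasurable
  refine ⟨fun x => max 0 (min (f0 x) 1), by fun_prop, fun x => ⟨by simp, by simp⟩, fun g => ?_⟩
  rw [hFφ, L2.inner_def]
  refine integral_congr_ae ?_
  filter_upwards [h0, h1, hf0] with x h0 h1 hx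
  have h0 : (0:ℝ) ≤ F x := h0
  rw [← hx, min_eq_left h1, max_eq_right h0]
  simp [mul_comm]

lemma KW_mk {n : ℕ} (μ : Measure (EE n)) [IsFiniteMeasure μ] (f : EE n → ℝ) (hf : Measurable f)
    (h01 : ∀ x, f x ∈ Set.Icc (0:ℝ) 1) : ∃ φ ∈ KW μ, ∀ g : Lp ℝ 2 μ, φ g = ∫ x, f x * g x ∂μ := by
  have hL : MemLp f 2 μ := MemLp.of_bound hf.aestronglyMeasurable 1
    (Eventually.of_forall fun x => by rw [Real.norm_of_nonneg (h01 x).1]; exact (h01 x).2)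
  have key : ∀ g : Lp ℝ 2 μ, ⟪hL.toLp f, g⟫ = ∫ x, f x * g x ∂μ := by
    intro g
    rw [L2.inner_def]
    refine integral_congr_ae ?_
    filter_upwards [hL.coeFn_toLp] with x hx
    simp [hx, mul_comm]
  refine ⟨StrongDual.toWeakDual (innerSL ℝ (hL.toLp f)), ⟨?_, ?_⟩, key⟩
  · simp only [Set.mem_ofPred_eq]
    have : ‖(innerSL ℝ (hL.toLp f) : StrongDual ℝ (Lp ℝ 2 μ))‖ ≤ 
      ‖(indicatorConstLp 2 MeasurableSet.univ (measure_ne_top μ _) (1:ℝ) : Lp ℝ 2 μ)‖ := by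
      rw [innerSL_apply_norm]
      refine Lp.norm_le_norm_of_ae_le ?_
      filter_upwards [hL.coeFn_toLp, indicatorConstLp_coeFn (p := 2) (hs := MeasurableSet.univ)
        (hμs := measure_ne_top μ _) (c := (1:ℝ))] with x h1 h2
      rw [h1, h2, Real.norm_of_nonneg (h01 x).1]; simpa using (h01 x).2
    exact this
  · intro s hs
    have : (StrongDual.toWeakDual (innerSL ℝ (hL.toLp f))) (indicatorConstLp 2 hs (measure_ne_top μ s) (1 : ℝ))
      = ∫ x in s, f x ∂μ := by
      rw [StrongDual.toWeakDual_apply, innerSL_apply_apply, real_inner_comm, L2.inner_indicatorConstLp_one]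
      refine integral_congr_ae (ae_restrict_of_ae hL.coeFn_toLp)
    rw [this]
    refine ⟨integral_nonneg fun x => (h01 x).1, ?_⟩
    calc _ ≤ ∫ x in s, (1:ℝ) ∂μ := integral_mono (hL.integrable (by norm_num)).integrableOn
            (integrable_const _) fun x => (h01 x).2
      _ = _ := by simp

lemma KW_interface {n : ℕ} (μ : Measure (EE n)) [IsFiniteMeasure μ] :
    ∃ (X : Type) (_ : TopologicalSpace X) (_ : BaireSpace X) (_ : FirstCountableTopology X)
      (_ : Nonempty X) (rep : X → EE n → ℝ),
      (∀ x, Measurable (rep x)) ∧ (∀ x y, rep x y ∈ Set.Icc (0:ℝ) 1) ∧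
      (∀ u, MemLp u 2 μ → Continuous fun x => ∫ y, rep x y * u y ∂μ) ∧
      (∀ f, Measurable f → (∀ y, f y ∈ Set.Icc (0:ℝ) 1) → ∃ x, rep x =ᵐ[μ] f) ∧
      (∀ (s : ℕ → X) (x : X), (∀ u, MemLp u 2 μ → Tendsto (fun m => ∫ y, rep (s m) y * u y ∂μ) atTop
        (𝓝 (∫ y, rep x y * u y ∂μ))) → Tendsto s atTop (𝓝 x)) := by
  have hc := KW_compact μ
  have : CompactSpace (KW μ) := isCompact_iff_compactSpace.mp hc
  have : Fact ((2:ℝ≥0∞) ≠ ⊤) := ⟨by norm_num⟩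
  have : TopologicalSpace.MetrizableSpace (KW μ) := WeakDual.metrizable_of_isCompact ℝ _ _ hc
  have hr := fun x : KW μ => KW_rep μ x.1 x.2
  choose rep hm h01 hrep using hr
  have hrepu : ∀ (x : KW μ) u (hu : MemLp u 2 μ), ∫ y, rep x y * u y ∂μ = x.1 (hu.toLp u) := by
    intro x u hu
    rw [hrep]
    refine integral_congr_ae ?_
    filter_upwards [hu.coeFn_toLp] with y hy
    rw [hy]
  have hmk : ∀ f, Measurable f → (∀ y, f y ∈ Set.Icc (0:ℝ) 1) → ∃ x, rep x =ᵐ[μ] f := by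
    intro f hf hf01
    obtain ⟨φ, hφ, hφg⟩ := KW_mk μ f hf hf01
    refine ⟨⟨φ, hφ⟩, ?_⟩
    have hfi : Integrable f μ := Integrable.of_bound hf.aestronglyMeasurable 1
      (Eventually.of_forall fun x => by rw [Real.norm_of_nonneg (hf01 x).1]; exact (hf01 x).2)
    have hri : Integrable (rep ⟨φ, hφ⟩) μ := Integrable.of_bound (hm _).aestronglyMeasurable 1
      (Eventually.of_forall fun x => by rw [Real.norm_of_nonneg (h01 _ x).1]; exact (h01 _ x).2)
    refine Integrable.ae_eq_of_forall_setIntegral_eq _ _ hri hfi fun s hs _ => ?_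
    have h1 := hrep ⟨φ, hφ⟩ (indicatorConstLp 2 hs (measure_ne_top μ s) (1 : ℝ))
    have h2 := hφg (indicatorConstLp 2 hs (measure_ne_top μ s) (1 : ℝ))
    have h3 : ∀ w : EE n → ℝ, ∫ x, w x * (indicatorConstLp 2 hs (measure_ne_top μ s) (1 : ℝ) : Lp ℝ 2 μ) x ∂μ
        = ∫ x in s, w x ∂μ := by
      intro w
      rw [← integral_indicator hs]
      refine integral_congr_ae ?_
      filter_upwards [indicatorConstLp_coeFn (p := 2) (hs := hs)
        (hμs := measure_ne_top μ _) (c := (1:ℝ))] with x hx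
      rw [hx]
      by_cases hxs : x ∈ s <;> simp [hxs]
    rw [h3] at h1 h2
    rw [← h1, ← h2]
  refine ⟨KW μ, inferInstance, inferInstance, inferInstance, ?_, rep, hm, h01, ?_, hmk, ?_⟩
  · obtain ⟨x, _⟩ := hmk (fun _ => 0) measurable_const (by simp)
    exact ⟨x⟩
  · intro u hu
    simp_rw [fun x => hrepu x u hu]
    exact (WeakDual.eval_continuous _).comp continuous_subtype_val
  · intro s x h
    rw [tendsto_subtype_rng, tendsto_iff_forall_eval_tendsto_topDualPairing]
    intro g
    have := h g (Lp.memLp g)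
    simp_rw [hrepu _ _ (Lp.memLp g), Lp.toLp_coeFn] at this
    exact this

/-- oscillating factor -/
def osc {n : ℕ} (i : Fin n) (a : ℝ) (x : EE n) : ℝ := Real.cos (2 * π * (a * x i))

lemma osc_cont {n : ℕ} (i : Fin n) (a : ℝ) : Continuous (osc i a) := by
  unfold osc; fun_prop

lemma osc_sq {n : ℕ} (i : Fin n) (a : ℝ) (x : EE n) :
    osc i a x ^ 2 = 1 / 2 + osc i (2 * a) x / 2 := by
  unfold osc
  rw [Real.cos_sq]; ring_nf

lemma osc_RL0 {n : ℕ} (i : Fin n) (u : EE n → ℝ) (hu : Integrable u) :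
    Tendsto (fun a : ℝ => ∫ x, u x * osc i a x) atTop (𝓝 0) := by
  have h := tendsto_integral_exp_inner_smul_cocompact (V := EE n) (fun x => (u x : ℂ))
  have h2 : Tendsto (fun a : ℝ => (EuclideanSpace.single i a : EE n)) atTop (cocompact (EE n)) := by
    rw [← Metric.cobounded_eq_cocompact, ← tendsto_norm_atTop_iff_cobounded]
    simpa using tendsto_abs_atTop_atTop
  have h3 := h.comp h2
  have h4 := (Complex.continuous_re.tendsto _).comp h3
  simp only [Complex.zero_re] at h4
  refine h4.congr fun a => ?_
  simp only [Function.comp]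
  have hi : Integrable (fun v : EE n => 𝐞 (-⟪v, EuclideanSpace.single i a⟫) • (u v : ℂ)) := by
    have := (Real.fourierIntegral_convergent_iff (μ := volume) (f := fun v => (u v : ℂ)) (EuclideanSpace.single i a)).2 hu.ofReal
    exact this
  have := (integral_re hi)
  simp only [RCLike.re_eq_complex_re] at this
  rw [← this]
  congr 1; ext v
  simp only [Circle.smul_def, Real.fourierChar_apply, smul_eq_mul, Complex.re_mul_ofReal]
  rw [Complex.exp_ofReal_mul_I_re, osc, mul_comm]
  simp [EuclideanSpace.inner_single_right]

lemma osc_RL {n : ℕ} (i : Fin n) (B : Set (EE n)) (hB : MeasurableSet B) (u : EE n → ℝ)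
    (hu : Integrable u (volume.restrict B)) :
    Tendsto (fun a : ℝ => ∫ x in B, u x * osc i a x) atTop (𝓝 0) := by
  have := osc_RL0 i (B.indicator u) ((integrable_indicator_iff hB).2 hu)
  refine this.congr fun a => ?_
  rw [← integral_indicator hB]
  congr 1; ext x
  by_cases hx : x ∈ B <;> simp [hx]

lemma int_bdd {n : ℕ} {μ : Measure (EE n)} [IsFiniteMeasure μ] {f : EE n → ℝ} (hf : Measurable f) (C : ℝ)
    (h : ∀ x, |f x| ≤ C) : Integrable f μ :=
  Integrable.of_bound hf.aestronglyMeasurable C (Eventually.of_forall h)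

lemma memLp_bdd {n : ℕ} {μ : Measure (EE n)} [IsFiniteMeasure μ] {f : EE n → ℝ} (hf : Measurable f) (C : ℝ)
    (h : ∀ x, |f x| ≤ C) : MemLp f 2 μ :=
  MemLp.of_bound hf.aestronglyMeasurable C (Eventually.of_forall h)

section abs
variable {n : ℕ} {B : Set (EE n)} [IsFiniteMeasure (volume.restrict B)] {X : Type} [TopologicalSpace X]
  {rep : X → EE n → ℝ}

lemma J_open (hm : ∀ x, Measurable (rep x)) (h01 : ∀ x y, rep x y ∈ Set.Icc (0:ℝ) 1)
    (hc : ∀ u, MemLp u 2 (volume.restrict B) → Continuous fun x => ∫ y in B, rep x y * u y) (c : ℝ) :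
    IsOpen {x | ∫ y in B, (rep x y - rep x y ^ 2) < c} := by
  rw [isOpen_iff_mem_nhds]
  intro x0 hx0
  have hm0 := hm x0
  have hL : MemLp (fun y => 1 - 2 * rep x0 y) 2 (volume.restrict B) := by
    refine memLp_bdd (by fun_prop) 3 fun y => ?_
    have := h01 x0 y
    rw [abs_le]; constructor <;> linarith [this.1, this.2]
  have hcont : Continuous fun x => (∫ y in B, rep x y * (1 - 2 * rep x0 y)) + ∫ y in B, rep x0 y ^ 2 :=
    (hc _ hL).add continuous_const
  have hI2 : ∀ x, Integrable (fun y => rep x y ^ 2) (volume.restrict B) := by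
    intro x
    have := hm x
    refine int_bdd (by fun_prop) 1 fun y => ?_
    have := h01 x y
    rw [abs_le]; constructor <;> nlinarith [this.1, this.2]
  have hI1 : ∀ x, Integrable (fun y => rep x y) (volume.restrict B) := by
    intro x
    refine int_bdd (hm x) 1 fun y => ?_
    have := h01 x y
    rw [abs_le]; constructor <;> nlinarith [this.1, this.2]
  have hI3 : ∀ x, Integrable (fun y => rep x y * (1 - 2 * rep x0 y)) (volume.restrict B) := by
    intro x
    have := hm x
    refine int_bdd (by fun_prop) 3 fun y => ?_
    have := h01 x y
    have := h01 x0 y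
    have a1 : |rep x y| ≤ 1 := by
      rw [abs_le]; constructor <;> nlinarith [(h01 x y).1, (h01 x y).2]
    have a2 : |1 - 2 * rep x0 y| ≤ 3 := by
      rw [abs_le]; constructor <;> linarith [this.1, this.2]
    rw [abs_mul]
    nlinarith [abs_nonneg (rep x y), abs_nonneg (1 - 2 * rep x0 y)]
  have hle : ∀ x, ∫ y in B, (rep x y - rep x y ^ 2) ≤
      (∫ y in B, rep x y * (1 - 2 * rep x0 y)) + ∫ y in B, rep x0 y ^ 2 := by
    intro x
    rw [← integral_add (hI3 x) (hI2 x0)]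
    refine integral_mono ((hI1 x).sub (hI2 x)) ((hI3 x).add (hI2 x0)) fun y => ?_
    simp only
    nlinarith [sq_nonneg (rep x y - rep x0 y)]
  have heq : (∫ y in B, rep x0 y * (1 - 2 * rep x0 y)) + ∫ y in B, rep x0 y ^ 2 =
      ∫ y in B, (rep x0 y - rep x0 y ^ 2) := by
    rw [← integral_add (hI3 x0) (hI2 x0)]
    congr 1; ext y; ring
  have hx0' : ∫ y in B, (rep x0 y - rep x0 y ^ 2) < c := hx0
  rw [← heq] at hx0'
  have := (hcont.continuousAt (x := x0)).eventually (gt_mem_nhds hx0')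
  filter_upwards [this] with x hx
  exact (hle x).trans_lt hx

lemma J_dense (i : Fin n) (hB : MeasurableSet B) (hm : ∀ x, Measurable (rep x)) (h01 : ∀ x y, rep x y ∈ Set.Icc (0:ℝ) 1)
    (hmk : ∀ f, Measurable f → (∀ y, f y ∈ Set.Icc (0:ℝ) 1) → ∃ x, rep x =ᵐ[volume.restrict B] f)
    (hseq : ∀ (s : ℕ → X) (x : X), (∀ u, MemLp u 2 (volume.restrict B) →
      Tendsto (fun m => ∫ y in B, rep (s m) y * u y) atTop
        (𝓝 (∫ y in B, rep x y * u y))) → Tendsto s atTop (𝓝 x)) (c : ℝ) (hc : 0 < c) :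
    Dense {x | ∫ y in B, (rep x y - rep x y ^ 2) < c} := by
  rw [dense_iff_inter_open]
  intro U hU hUne
  by_contra hcon
  have hge : ∀ x ∈ U, c ≤ ∫ y in B, (rep x y - rep x y ^ 2) := by
    intro x hx
    by_contra h
    exact hcon ⟨x, hx, not_le.1 h⟩
  set J : X → ℝ := fun x => ∫ y in B, (rep x y - rep x y ^ 2) with hJ
  set M : ℝ := (volume.restrict B).real Set.univ with hM
  have hI : ∀ x, Integrable (fun y => rep x y - rep x y ^ 2) (volume.restrict B) := by
    intro x
    have := hm x
    refine int_bdd (by fun_prop) 1 fun y => ?_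
    have := h01 x y
    rw [abs_le]; constructor <;> nlinarith [this.1, this.2]
  have hMpos : 0 < M := by
    obtain ⟨x, hx⟩ := hUne
    have h1 : J x ≤ ∫ y in B, (1:ℝ) := by
      refine integral_mono (hI x) (integrable_const _) fun y => ?_
      have := h01 x y
      simp only
      nlinarith [this.1, this.2]
    have h2 := hge x hx
    simp only [integral_const, smul_eq_mul, mul_one] at h1
    linarith
  have hbdd : BddBelow (J '' U) := ⟨c, by rintro _ ⟨x, hx, rfl⟩; exact hge x hx⟩
  have hδ : 0 < c ^ 2 / (4 * M) := by positivity
  obtain ⟨_, ⟨x, hx, rfl⟩, hxlt⟩ := exists_lt_of_csInf_lt (hUne.image J)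
    (show sInf (J '' U) < sInf (J '' U) + c ^ 2 / (4 * M) by linarith)
  have hmx := hm x
  set f := rep x with hf
  have hf0 : ∀ y, 0 ≤ f y := fun y => (h01 x y).1
  have hf1 : ∀ y, f y ≤ 1 := fun y => (h01 x y).2
  have hw0 : ∀ y, 0 ≤ f y - f y ^ 2 := fun y => by nlinarith [hf0 y, hf1 y]
  have hw1 : ∀ y, f y - f y ^ 2 ≤ 1 := fun y => by nlinarith [hf0 y, hf1 y]
  have hoscm : ∀ a, Measurable (osc i a) := fun a => (osc_cont i a).measurable
  have hosc1 : ∀ a y, |osc i a y| ≤ 1 := fun a y => Real.abs_cos_le_one _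
  have hmk' : ∀ m : ℕ, ∃ z, rep z =ᵐ[volume.restrict B] fun y => f y + (f y - f y ^ 2) * osc i m y := by
    intro m
    refine hmk _ (by have := hoscm m; fun_prop) fun y => ?_
    have h1 := abs_le.1 (hosc1 m y)
    constructor
    · nlinarith [hw0 y, sq_nonneg (f y)]
    · nlinarith [hw0 y, sq_nonneg (1 - f y)]
  choose z hz using hmk'
  have hcast : Tendsto (fun m : ℕ => (m : ℝ)) atTop atTop := tendsto_natCast_atTop_atTop
  have hzx : Tendsto z atTop (𝓝 x) := by
    refine hseq z x fun u hu => ?_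
    have hui : Integrable u (volume.restrict B) := hu.integrable (by norm_num)
    have h1 : Integrable (fun y => f y * u y) (volume.restrict B) :=
      hui.bdd_mul (c := 1) hmx.aestronglyMeasurable (Eventually.of_forall fun y => by
        rw [Real.norm_of_nonneg (hf0 y)]; exact hf1 y)
    have h2 : Integrable (fun y => (f y - f y ^ 2) * u y) (volume.restrict B) :=
      hui.bdd_mul (c := 1) (by fun_prop) (Eventually.of_forall fun y => by
        rw [Real.norm_of_nonneg (hw0 y)]; exact hw1 y)
    have h3 : ∀ a, Integrable (fun y => (f y - f y ^ 2) * u y * osc i a y) (volume.restrict B) := fun a =>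
      h2.mul_bdd (c := 1) (hoscm a).aestronglyMeasurable (Eventually.of_forall fun y => hosc1 a y)
    have h4 := ((osc_RL i B hB _ h2).comp hcast).const_add (∫ y in B, f y * u y)
    rw [add_zero] at h4
    refine h4.congr fun m => ?_
    simp only [Function.comp]
    rw [← integral_add h1 (h3 m)]
    refine integral_congr_ae ?_
    filter_upwards [hz m] with y hy
    rw [hy]; ring
  have hw2 : Integrable (fun y => (f y - f y ^ 2) ^ 2) (volume.restrict B) := by
    refine int_bdd (by fun_prop) 1 fun y => ?_
    rw [abs_of_nonneg (sq_nonneg _)]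
    nlinarith [hw0 y, hw1 y]
  have hw3 : Integrable (fun y => (f y - f y ^ 2) * (1 - 2 * f y)) (volume.restrict B) := by
    refine int_bdd (by fun_prop) 1 fun y => ?_
    rw [abs_mul, abs_of_nonneg (hw0 y)]
    have : |1 - 2 * f y| ≤ 1 := by rw [abs_le]; constructor <;> linarith [hf0 y, hf1 y]
    nlinarith [hw0 y, hw1 y, abs_nonneg (1 - 2 * f y)]
  have hJz : Tendsto (fun m => J (z m)) atTop (𝓝 (J x - (∫ y in B, (f y - f y ^ 2) ^ 2) / 2)) := by
    have t1 := (osc_RL i B hB _ hw3).comp hcast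
    have t2 := (osc_RL i B hB _ hw2).comp (hcast.const_mul_atTop (show (0:ℝ) < 2 by norm_num))
    have t3 := (t1.sub (t2.const_mul (1/2))).const_add (J x - (∫ y in B, (f y - f y ^ 2) ^ 2) / 2)
    simp only [mul_zero, sub_zero, add_zero] at t3
    refine t3.congr fun m => ?_
    simp only [Function.comp]
    have i1 : Integrable (fun y => (f y - f y ^ 2) * (1 - 2 * f y) * osc i m y) (volume.restrict B) :=
      hw3.mul_bdd (c := 1) (hoscm _).aestronglyMeasurable (Eventually.of_forall fun y => hosc1 _ y)
    have i2 : Integrable (fun y => (f y - f y ^ 2) ^ 2 * osc i (2 * m) y) (volume.restrict B) :=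
      hw2.mul_bdd (c := 1) (hoscm _).aestronglyMeasurable (Eventually.of_forall fun y => hosc1 _ y)
    have e : J (z m) = ∫ y in B, (((f y - f y ^ 2) - (1/2) * (f y - f y ^ 2) ^ 2) +
        ((f y - f y ^ 2) * (1 - 2 * f y) * osc i m y - (1/2) * ((f y - f y ^ 2) ^ 2 * osc i (2 * m) y))) := by
      refine integral_congr_ae ?_
      filter_upwards [hz m] with y hy
      rw [hy]
      have := osc_sq i m y
      have e2 : osc i (2 * m) y = 2 * osc i m y ^ 2 - 1 := by linarith
      rw [e2]; ring
    have j1 : Integrable (fun y => (f y - f y ^ 2) - (1/2) * (f y - f y ^ 2) ^ 2) (volume.restrict B) :=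
      (hI x).sub (hw2.const_mul _)
    have j2 : Integrable (fun y => (f y - f y ^ 2) * (1 - 2 * f y) * osc i m y -
        (1/2) * ((f y - f y ^ 2) ^ 2 * osc i (2 * m) y)) (volume.restrict B) := i1.sub (i2.const_mul _)
    rw [e, integral_add j1 j2,
      integral_sub (hI x) (hw2.const_mul _), integral_sub i1 (i2.const_mul _),
      integral_const_mul, integral_const_mul]
    ring
  have hlow : c ^ 2 / M ≤ ∫ y in B, (f y - f y ^ 2) ^ 2 := by
    have h1 : ∫ y in B, (2 * (c / M) * (f y - f y ^ 2) - (c / M) ^ 2) ≤ ∫ y in B, (f y - f y ^ 2) ^ 2 := by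
      refine integral_mono (((hI x).const_mul _).sub (integrable_const _)) hw2 fun y => ?_
      simp only
      nlinarith [sq_nonneg ((f y - f y ^ 2) - c / M)]
    rw [integral_sub ((hI x).const_mul _) (integrable_const _), integral_const_mul, integral_const,
      smul_eq_mul, ← hM] at h1
    have h2 : 2 * (c / M) * c ≤ 2 * (c / M) * J x := by
      have := hge x hx
      gcongr
    have h3 : c ^ 2 / M = 2 * (c / M) * c - M * (c / M) ^ 2 := by field_simp; ring
    rw [h3]; linarith
  have hlim : J x - (∫ y in B, (f y - f y ^ 2) ^ 2) / 2 < sInf (J '' U) := by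
    have : c ^ 2 / (4 * M) = c ^ 2 / M / 4 := by field_simp
    have h5 : 0 < c ^ 2 / M := by positivity
    linarith
  obtain ⟨m, hm1, hm2⟩ := ((hzx.eventually (hU.mem_nhds hx)).and (hJz.eventually (gt_mem_nhds hlim))).exists
  exact absurd (csInf_le hbdd ⟨z m, hm1, rfl⟩) (not_le.2 hm2)

end abs

/-- admissible test fields -/
def Adm {n : ℕ} (φ : EE n → EE n) : Prop :=
  ContDiff ℝ 1 φ ∧ HasCompactSupport φ ∧ ∀ x, ‖φ x‖ ≤ 1

lemma divg_cont {n : ℕ} {φ : EE n → EE n} (h : ContDiff ℝ 1 φ) : Continuous (divg φ) := by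
  have := h.continuous_fderiv (by norm_num)
  unfold divg
  fun_prop

lemma divg_memLp {n : ℕ} {φ : EE n → EE n} (h : Adm φ) (B : Set (EE n)) :
    MemLp (divg φ) 2 (volume.restrict B) := by
  refine MemLp.restrict _ ((divg_cont h.1).memLp_of_hasCompactSupport ?_)
  have h2 : HasCompactSupport (fderiv ℝ φ) := h.2.1.fderiv ℝ
  refine h2.mono' (Function.support_subset_iff'.2 fun x hx => ?_) 
  have : fderiv ℝ φ x = 0 := by
    by_contra hne
    exact hx (subset_tsupport _ hne)
  simp [divg, this]

lemma test_field {n : ℕ} (i : Fin n) (a s : ℝ) (hs : |s| ≤ 1) : ∃ φ : EE n → EE n, Adm φ ∧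
    ∀ x ∈ Metric.ball (0 : EE n) 1, divg φ x = s * (2 * π * a) * osc i a x := by
  let χ : ContDiffBump (0 : EE n) := ⟨1, 2, by norm_num, by norm_num⟩
  refine ⟨fun x => (χ x * (s * Real.sin (2 * π * (a * x i)))) • EuclideanSpace.single i (1:ℝ), ⟨?_, ?_, ?_⟩, ?_⟩
  · have h1 : ContDiff ℝ 1 χ := χ.contDiff
    have h2 : ContDiff ℝ 1 (fun x : EE n => x i) := by fun_prop
    fun_prop
  · have h1 : HasCompactSupport χ := χ.hasCompactSupport
    exact (h1.mul_right (f' := fun x : EE n => s * Real.sin (2 * π * (a * x i)))).smul_right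
  · intro x
    rw [norm_smul, PiLp.norm_single, norm_one, mul_one, norm_mul, norm_mul,
      Real.norm_of_nonneg χ.nonneg]
    have h1 := χ.le_one (x := x)
    have h2 := χ.nonneg (x := x)
    have h3 : ‖Real.sin (2 * π * (a * x i))‖ ≤ 1 := Real.abs_sin_le_one _
    have h4 : ‖s‖ ≤ 1 := hs
    calc _ ≤ 1 * (1 * 1 : ℝ) := by gcongr
      _ = 1 := by norm_num
  · intro x hx
    have hev : (fun x : EE n => (χ x * (s * Real.sin (2 * π * (a * x i)))) • EuclideanSpace.single i (1:ℝ)) =ᶠ[𝓝 x]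
      fun x => (s * Real.sin (2 * π * (a * x i))) • (EuclideanSpace.single i (1:ℝ) : EE n) := by
      filter_upwards [Metric.isOpen_ball.mem_nhds hx] with y hy
      rw [χ.one_of_mem_closedBall (Metric.ball_subset_closedBall hy), one_mul]
    have hd0 : HasFDerivAt (fun y : EE n => y i) (EuclideanSpace.proj i : EE n →L[ℝ] ℝ) x :=
      (EuclideanSpace.proj i : EE n →L[ℝ] ℝ).hasFDerivAt
    have hd := (((hd0.const_mul a).const_mul (2 * π)).sin.const_mul s).smul_const (EuclideanSpace.single i (1:ℝ) : EE n)
    unfold divg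
    rw [hev.fderiv_eq, hd.fderiv]
    rw [Finset.sum_eq_single i]
    · simp [osc]; ring
    · intro j _ hj
      simp [hj]
    · simp

section abs
variable {n : ℕ} {X : Type} [TopologicalSpace X] {rep : X → EE n → ℝ}

lemma P_open {B : Set (EE n)} 
    (hc : ∀ u, MemLp u 2 (volume.restrict B) → Continuous fun x => ∫ y in B, rep x y * u y) (k : ℝ) :
    IsOpen {x | ∃ φ : EE n → EE n, Adm φ ∧ k < ∫ y in B, rep x y * divg φ y} := by
  have : {x | ∃ φ : EE n → EE n, Adm φ ∧ k < ∫ y in B, rep x y * divg φ y} =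
    ⋃ (φ : EE n → EE n) (_ : Adm φ), {x | k < ∫ y in B, rep x y * divg φ y} := by
    ext x; simp
  rw [this]
  exact isOpen_iUnion fun φ => isOpen_iUnion fun hφ =>
    isOpen_lt continuous_const (hc _ (divg_memLp hφ B))

lemma P_dense (i : Fin n) (hm : ∀ x, Measurable (rep x)) (h01 : ∀ x y, rep x y ∈ Set.Icc (0:ℝ) 1)
    (hmk : ∀ f, Measurable f → (∀ y, f y ∈ Set.Icc (0:ℝ) 1) →
      ∃ x, rep x =ᵐ[volume.restrict (Metric.ball (0 : EE n) 1)] f)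
    (hseq : ∀ (s : ℕ → X) (x : X), (∀ u, MemLp u 2 (volume.restrict (Metric.ball (0 : EE n) 1)) →
      Tendsto (fun m => ∫ y in Metric.ball (0 : EE n) 1, rep (s m) y * u y) atTop
        (𝓝 (∫ y in Metric.ball (0 : EE n) 1, rep x y * u y))) → Tendsto s atTop (𝓝 x)) (k : ℝ) :
    Dense {x | ∃ φ : EE n → EE n, Adm φ ∧ k < ∫ y in Metric.ball (0 : EE n) 1, rep x y * divg φ y} := by
  set B := Metric.ball (0 : EE n) 1 with hBdef
  have hB : MeasurableSet B := Metric.isOpen_ball.measurableSet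
  have : IsFiniteMeasure (volume.restrict B) := ⟨by
    rw [Measure.restrict_apply_univ]; exact measure_ball_lt_top⟩
  rw [dense_iff_inter_open]
  intro U hU hUne
  by_contra hcon
  have hle : ∀ x ∈ U, ∀ φ : EE n → EE n, Adm φ → ∫ y in B, rep x y * divg φ y ≤ k := by
    intro x hx φ hφ
    by_contra h
    exact hcon ⟨x, hx, φ, hφ, not_le.1 h⟩
  obtain ⟨x, hx⟩ := hUne
  have hmx := hm x
  set f := rep x with hf
  have hf0 : ∀ y, 0 ≤ f y := fun y => (h01 x y).1
  have hf1 : ∀ y, f y ≤ 1 := fun y => (h01 x y).2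
  have hoscm : ∀ a, Measurable (osc i a) := fun a => (osc_cont i a).measurable
  have hosc1 : ∀ a y, |osc i a y| ≤ 1 := fun a y => Real.abs_cos_le_one _
  have hcast : Tendsto (fun m : ℕ => (m : ℝ)) atTop atTop := tendsto_natCast_atTop_atTop
  have hfu : ∀ u, MemLp u 2 (volume.restrict B) → Integrable (fun y => f y * u y) (volume.restrict B) := fun u hu =>
      (hu.integrable (by norm_num)).bdd_mul (c := 1) hmx.aestronglyMeasurable (Eventually.of_forall fun y => by
        rw [Real.norm_of_nonneg (hf0 y)]; exact hf1 y)
  -- the perturbation with constants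
  have hmk1 : ∀ j : ℕ, ∃ z, rep z =ᵐ[volume.restrict B] fun y => (1 - 1 / ((j:ℝ) + 1)) * f y + 1 / ((j:ℝ) + 1) / 2 := by
    intro j
    have ht0 : 0 < 1 / ((j:ℝ) + 1) := by positivity
    have ht1 : 1 / ((j:ℝ) + 1) ≤ 1 := by rw [div_le_one (by positivity)]; linarith [(Nat.cast_nonneg j : (0:ℝ) ≤ j)]
    refine hmk _ (by fun_prop) fun y => ⟨?_, ?_⟩
    · have := hf0 y
      have : 0 ≤ 1 - 1 / ((j:ℝ) + 1) := by linarith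
      positivity
    · nlinarith [hf1 y, hf0 y]
  choose z hz using hmk1
  have hzx : Tendsto z atTop (𝓝 x) := by
    refine hseq z x fun u hu => ?_
    have hui : Integrable u (volume.restrict B) := hu.integrable (by norm_num)
    have t1 := tendsto_one_div_add_atTop_nhds_zero_nat (𝕜 := ℝ)
    have t2 := ((t1.const_sub 1).mul_const (∫ y in B, f y * u y)).add ((t1.div_const 2).mul_const (∫ y in B, u y))
    simp only [sub_zero, one_mul, zero_div, zero_mul, add_zero] at t2
    refine t2.congr fun j => ?_
    rw [← integral_const_mul, ← integral_const_mul, ← integral_add ((hfu u hu).const_mul _) (hui.const_mul _)]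
    refine integral_congr_ae ?_
    filter_upwards [hz j] with y hy
    rw [hy]; ring
  obtain ⟨j, hj⟩ := (hzx.eventually (hU.mem_nhds hx)).exists
  have hzj := hz j
  have ht0 : 0 < 1 / ((j:ℝ) + 1) := by positivity
  have ht1 : 1 / ((j:ℝ) + 1) ≤ 1 := by rw [div_le_one (by positivity)]; linarith [(Nat.cast_nonneg j : (0:ℝ) ≤ j)]
  set t : ℝ := 1 / ((j:ℝ) + 1) with ht
  set x1 := z j with hx1
  have hmk2 : ∀ m : ℕ, ∃ z, rep z =ᵐ[volume.restrict B] fun y => (1 - t) * f y + t / 2 + t / 2 * osc i m y := by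
    intro m
    refine hmk _ (by have := hoscm m; fun_prop) fun y => ?_
    have := abs_le.1 (hosc1 m y)
    have h0 := hf0 y
    have h3 : 0 ≤ 1 - t := by linarith
    constructor
    · nlinarith [mul_nonneg h3 h0]
    · nlinarith [mul_le_mul_of_nonneg_left (hf1 y) h3]
  choose h hh using hmk2
  have hIx : ∀ w u, MemLp u 2 (volume.restrict B) → Integrable (fun y => rep w y * u y) (volume.restrict B) := fun w u hu =>
      (hu.integrable (by norm_num)).bdd_mul (c := 1) (hm w).aestronglyMeasurable (Eventually.of_forall fun y => by
        rw [Real.norm_of_nonneg (h01 w y).1]; exact (h01 w y).2)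
  have hdiff : ∀ m : ℕ, ∀ u, MemLp u 2 (volume.restrict B) →
      ∫ y in B, rep (h m) y * u y = (∫ y in B, rep x1 y * u y) + t / 2 * ∫ y in B, u y * osc i m y := by
    intro m u hu
    have hui : Integrable u (volume.restrict B) := hu.integrable (by norm_num)
    have h3 : Integrable (fun y => u y * osc i m y) (volume.restrict B) :=
      hui.mul_bdd (c := 1) (hoscm _).aestronglyMeasurable (Eventually.of_forall fun y => hosc1 _ y)
    rw [← integral_const_mul, ← integral_add (hIx _ _ hu) (h3.const_mul _)]
    refine integral_congr_ae ?_
    filter_upwards [hh m, hzj] with y hy hy2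
    rw [hy, hy2]; ring
  have hhx : Tendsto h atTop (𝓝 x1) := by
    refine hseq h x1 fun u hu => ?_
    have hui : Integrable u (volume.restrict B) := hu.integrable (by norm_num)
    have t1 := (((osc_RL i B hB u hui).comp hcast).const_mul (t / 2)).const_add (∫ y in B, rep x1 y * u y)
    simp only [mul_zero, add_zero] at t1
    refine t1.congr fun m => ?_
    rw [hdiff m u hu]; rfl
  have hM : 0 < volume.real B := by
    rw [measureReal_def]
    exact ENNReal.toReal_pos (Metric.measure_ball_pos _ _ one_pos).ne' measure_ball_lt_top.ne
  have hosc2 : Tendsto (fun m : ℕ => ∫ y in B, osc i m y ^ 2) atTop (𝓝 (volume.real B / 2)) := by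
    have t1 := (((osc_RL i B hB (fun _ => 1) (integrable_const _)).comp
      (hcast.const_mul_atTop (show (0:ℝ) < 2 by norm_num))).div_const 2).const_add (volume.real B / 2)
    simp only [zero_div, add_zero] at t1
    refine t1.congr fun m => ?_
    simp only [Function.comp, osc_sq, one_mul]
    have i1 : Integrable (osc i (2 * m)) (volume.restrict B) := int_bdd (hoscm _) 1 (hosc1 _)
    rw [integral_add (integrable_const _) (i1.div_const _), integral_const, integral_div]
    simp; ring
  have hup : ∀ᶠ m : ℕ in atTop, t * π * m * (∫ y in B, osc i m y ^ 2) ≤ 2 * k := by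
    filter_upwards [hhx.eventually (hU.mem_nhds hj)] with m hmU
    obtain ⟨φ, hφ, hφd⟩ := test_field i (m:ℝ) 1 (by simp)
    obtain ⟨ψ, hψ, hψd⟩ := test_field i (m:ℝ) (-1) (by simp)
    have e1 := hle _ hmU φ hφ
    have e2 := hle _ hj ψ hψ
    rw [hdiff m _ (divg_memLp hφ B)] at e1
    have e3 : ∫ y in B, rep x1 y * divg ψ y = - ∫ y in B, rep x1 y * divg φ y := by
      rw [← integral_neg]
      refine setIntegral_congr_fun hB fun y hy => ?_
      rw [hφd y hy, hψd y hy]; ring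
    have e4 : ∫ y in B, divg φ y * osc i m y = 2 * π * m * ∫ y in B, osc i m y ^ 2 := by
      rw [← integral_const_mul]
      refine setIntegral_congr_fun hB fun y hy => ?_
      rw [hφd y hy]; ring
    rw [e4] at e1
    change (∫ y in B, rep x1 y * divg ψ y) ≤ k at e2
    rw [e3] at e2
    nlinarith
  have htop : Tendsto (fun m : ℕ => t * π * m * (∫ y in B, osc i m y ^ 2)) atTop atTop := by
    refine Tendsto.atTop_mul_pos (by positivity) (hcast.const_mul_atTop (by positivity)) hosc2
  obtain ⟨m, h1, h2⟩ := (hup.and (htop.eventually_gt_atTop (2 * k))).exists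
  linarith

end abs

lemma gaussSc_eq {n : ℕ} (ε : ℝ) (x : EE n) :
    gaussSc ε x = (ε⁻¹ ^ n * (2 * π) ^ (-(n:ℝ) / 2)) * Real.exp (-(1 / (2 * ε ^ 2)) * ‖x‖ ^ 2) := by
  simp only [gaussSc, scaleFn, gauss, finrank_euclideanSpace, Fintype.card_fin]
  rw [norm_smul, mul_pow, mul_assoc]
  congr 3
  rw [Real.norm_eq_abs, sq_abs]
  ring

lemma gexp_int {n : ℕ} {b : ℝ} (hb : 0 < b) :
    Integrable (fun x : EE n => Real.exp (-b * ‖x‖ ^ 2)) := by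
  have h := GaussianFourier.integrable_cexp_neg_mul_sq_norm_add (V := EE n) (b := (b:ℂ)) (by simpa using hb) 0 0
  have := h.norm
  refine this.congr (Eventually.of_forall fun x => ?_)
  simp only [Complex.norm_exp]
  congr 1
  simp [← Complex.ofReal_pow]

lemma gexp_int' {n : ℕ} {b : ℝ} (hb : 0 < b) :
    Integrable (fun x : EE n => ‖x‖ * Real.exp (-b * ‖x‖ ^ 2)) := by
  have h := (gexp_int (n := n) (half_pos hb)).const_mul (1 + 1 / b)
  refine h.mono' (by fun_prop) (Eventually.of_forall fun x => ?_)
  rw [Real.norm_of_nonneg (by positivity)]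
  have e1 : Real.exp (-b * ‖x‖ ^ 2) = Real.exp (-(b/2) * ‖x‖ ^ 2) * Real.exp (-(b/2) * ‖x‖ ^ 2) := by
    rw [← Real.exp_add]; ring_nf
  have e2 : ‖x‖ * Real.exp (-(b/2) * ‖x‖ ^ 2) ≤ 1 + 1 / b := by
    rw [neg_mul, Real.exp_neg, ← div_eq_mul_inv, div_le_iff₀ (Real.exp_pos _)]
    have := Real.add_one_le_exp (b / 2 * ‖x‖ ^ 2)
    have h3 : (1 + 1 / b) * (b / 2 * ‖x‖ ^ 2 + 1) ≤ (1 + 1 / b) * Real.exp (b / 2 * ‖x‖ ^ 2) := by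
      gcongr
    refine le_trans ?_ h3
    have : (1 + 1 / b) * (b / 2 * ‖x‖ ^ 2 + 1) = ‖x‖ ^ 2 / 2 + b / 2 * ‖x‖ ^ 2 + 1 + 1 / b := by
      field_simp; ring
    rw [this]
    have h4 : 0 ≤ b / 2 * ‖x‖ ^ 2 + 1 / b := by positivity
    nlinarith [sq_nonneg (‖x‖ - 1)]
  rw [e1, ← mul_assoc]
  gcongr

lemma gaussSc_int {n : ℕ} {ε : ℝ} (hε : 0 < ε) : Integrable (gaussSc ε : EE n → ℝ) := by
  have : (gaussSc ε : EE n → ℝ) = fun x => (ε⁻¹ ^ n * (2 * π) ^ (-(n:ℝ) / 2)) * Real.exp (-(1 / (2 * ε ^ 2)) * ‖x‖ ^ 2) := by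
    ext x; exact gaussSc_eq ε x
  rw [this]
  exact (gexp_int (by positivity)).const_mul _

lemma gaussSc_ft {n : ℕ} {ε : ℝ} (hε : 0 < ε) (ξ : EE n) :
    𝓕 (fun x : EE n => (gaussSc ε x : ℂ)) ξ = (Real.exp (-(2 * π ^ 2 * ε ^ 2) * ‖ξ‖ ^ 2) : ℝ) := by
  have h := fourier_gaussian_innerProductSpace (V := EE n) (b := ((1 / (2 * ε ^ 2) : ℝ) : ℂ))
    (by rw [Complex.ofReal_re]; positivity) ξ
  have e0 : ((π : ℂ) / ((1 / (2 * ε ^ 2) : ℝ) : ℂ)) ^ ((Module.finrank ℝ (EE n) : ℂ) / 2) =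
      (((2 * π) ^ ((n:ℝ) / 2) * ε ^ n : ℝ) : ℂ) := by
    have a : ((π : ℂ) / ((1 / (2 * ε ^ 2) : ℝ) : ℂ)) = ((2 * π * ε ^ 2 : ℝ) : ℂ) := by
      push_cast
      field_simp
    have b : ((Module.finrank ℝ (EE n) : ℂ) / 2) = (((n:ℝ) / 2 : ℝ) : ℂ) := by simp
    rw [a, b, ← Complex.ofReal_cpow (by positivity), Real.mul_rpow (by positivity) (by positivity)]
    congr 2
    rw [← Real.rpow_natCast ε 2, ← Real.rpow_mul hε.le, ← Real.rpow_natCast ε n]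
    congr 1
    push_cast; ring
  rw [e0] at h
  have e1 : 𝓕 (fun x : EE n => (gaussSc ε x : ℂ)) ξ = ((ε⁻¹ ^ n * (2 * π) ^ (-(n:ℝ) / 2) : ℝ) : ℂ) *
      𝓕 (fun v : EE n => Complex.exp (-((1 / (2 * ε ^ 2) : ℝ) : ℂ) * ‖v‖ ^ 2)) ξ := by
    rw [Real.fourier_eq, Real.fourier_eq, ← integral_const_mul]
    congr 1; ext v
    rw [gaussSc_eq]
    simp only [Circle.smul_def, smul_eq_mul]
    push_cast
    ring
  rw [e1, h, ← mul_assoc, ← Complex.ofReal_mul]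
  have e2 : ε⁻¹ ^ n * (2 * π) ^ (-(n:ℝ) / 2) * ((2 * π) ^ ((n:ℝ) / 2) * ε ^ n) = 1 := by
    have : (2 * π) ^ (-(n:ℝ) / 2) * (2 * π) ^ ((n:ℝ) / 2) = 1 := by
      rw [← Real.rpow_add (by positivity)]
      ring_nf; simp
    calc _ = (ε⁻¹ ^ n * ε ^ n) * ((2 * π) ^ (-(n:ℝ) / 2) * (2 * π) ^ ((n:ℝ) / 2)) := by ring
      _ = 1 := by rw [this, ← mul_pow, inv_mul_cancel₀ hε.ne']; simp
  rw [e2, Complex.ofReal_one, one_mul, Complex.ofReal_exp]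
  congr 1
  push_cast
  field_simp

lemma conv_ft {n : ℕ} {ε : ℝ} (hε : 0 < ε) (v : EE n → ℝ) (hv : Integrable v) (ξ : EE n) :
    𝓕 (fun x : EE n => (conv (gaussSc ε) v x : ℂ)) ξ =
      (Real.exp (-(2 * π ^ 2 * ε ^ 2) * ‖ξ‖ ^ 2) : ℝ) * 𝓕 (fun x : EE n => (v x : ℂ)) ξ := by
  rw [← gaussSc_ft hε]
  have := Real.fourier_mul_convolution_eq (gaussSc_int (n := n) hε).ofReal hv.ofReal (R := ℂ) ξ
  refine Eq.trans ?_ this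
  refine congrArg (fun F : EE n → ℂ => 𝓕 F ξ) ?_
  ext x
  simp only [conv, MeasureTheory.convolution_def]
  rw [← integral_complex_ofReal]
  congr 1; ext y
  simp

/-- the (finite) integral expressing the seminorm -/
def FF {n : ℕ} (ε : ℝ) (v : EE n → ℝ) : ℝ :=
  ∫ ξ : EE n, ‖ξ‖ * Real.exp (-(4 * π ^ 2 * ε ^ 2) * ‖ξ‖ ^ 2) * ‖𝓕 (fun x : EE n => (v x : ℂ)) ξ‖ ^ 2

lemma ft_bound {n : ℕ} (v : EE n → ℝ) (ξ : EE n) :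
    ‖𝓕 (fun x : EE n => (v x : ℂ)) ξ‖ ≤ ∫ x, |v x| := by
  refine le_trans (VectorFourier.norm_fourierIntegral_le_integral_norm 𝐞 volume (innerₗ (EE n)) _ ξ) ?_
  simp

lemma ft_cont {n : ℕ} (v : EE n → ℝ) (hv : Integrable v) :
    Continuous (𝓕 (fun x : EE n => (v x : ℂ))) :=
  VectorFourier.fourierIntegral_continuous Real.continuous_fourierChar (by exact continuous_inner) hv.ofReal

lemma H12_eq {n : ℕ} {ε : ℝ} (hε : 0 < ε) (v : EE n → ℝ) (hv : Integrable v) :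
    H12e (conv (gaussSc ε) v) = ENNReal.ofReal (FF ε v) := by
  have hc := ft_cont v hv
  have hi : Integrable (fun ξ : EE n => ‖ξ‖ * Real.exp (-(4 * π ^ 2 * ε ^ 2) * ‖ξ‖ ^ 2) *
      ‖𝓕 (fun x : EE n => (v x : ℂ)) ξ‖ ^ 2) := by
    refine (gexp_int' (n := n) (b := 4 * π ^ 2 * ε ^ 2) (by positivity)).mul_bdd (c := (∫ x, |v x|) ^ 2)
      (by fun_prop) (Eventually.of_forall fun ξ => ?_)
    rw [Real.norm_of_nonneg (by positivity)]
    gcongr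
    exact ft_bound v ξ
  rw [FF, ofReal_integral_eq_lintegral_ofReal hi (Eventually.of_forall fun ξ => by positivity), H12e]
  congr 1; ext ξ
  rw [conv_ft hε v hv]
  have e : Real.exp (-(4 * π ^ 2 * ε ^ 2) * ‖ξ‖ ^ 2) = Real.exp (-(2 * π ^ 2 * ε ^ 2) * ‖ξ‖ ^ 2) ^ 2 := by
    rw [← Real.exp_nat_mul]; congr 1; push_cast; ring
  have e2 : ‖ξ‖ * Real.exp (-(4 * π ^ 2 * ε ^ 2) * ‖ξ‖ ^ 2) *
      ‖𝓕 (fun x : EE n => (v x : ℂ)) ξ‖ ^ 2 = ‖ξ‖ *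
      ‖(Real.exp (-(2 * π ^ 2 * ε ^ 2) * ‖ξ‖ ^ 2) : ℝ) * 𝓕 (fun x : EE n => (v x : ℂ)) ξ‖ ^ 2 := by
    rw [e, norm_mul, Complex.norm_real, Real.norm_of_nonneg (Real.exp_pos _).le]; ring
  rw [e2, ENNReal.ofReal_mul (norm_nonneg _), ENNReal.ofReal_pow (norm_nonneg _), ofReal_norm,
    ofReal_norm]
  rfl

lemma FF_smooth {n : ℕ} (g : EE n → ℝ) (hg : ContDiff ℝ (⊤ : ℕ∞) g) (hs : HasCompactSupport g) :
    ∃ C : ℝ, ∀ ε, FF ε g ≤ C := by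
  have hs' : HasCompactSupport (fun x => (g x : ℂ)) := hs.comp_left (g := fun r : ℝ => (r : ℂ)) (by simp)
  have hg' : ContDiff ℝ (⊤ : ℕ∞) (fun x => (g x : ℂ)) := Complex.ofRealCLM.contDiff.comp hg
  let S := hs'.toSchwartzMap hg'
  have hS : 𝓕 (fun x : EE n => (g x : ℂ)) = (𝓕 S : SchwartzMap (EE n) ℂ) := by
    rw [SchwartzMap.fourier_coe]; rfl
  have hgi : Integrable g := hg.continuous.integrable_of_hasCompactSupport hs
  have hi : Integrable (fun ξ : EE n => ‖ξ‖ * ‖𝓕 (fun x : EE n => (g x : ℂ)) ξ‖ ^ 2) := by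
    have h1 := (𝓕 S : SchwartzMap (EE n) ℂ).integrable_pow_mul volume 1
    rw [← hS] at h1
    have hc := ft_cont g hgi
    have h2 := h1.mul_bdd (c := ∫ x, |g x|) (g := fun ξ => ‖𝓕 (fun x : EE n => (g x : ℂ)) ξ‖)
      (by fun_prop) (Eventually.of_forall fun ξ => by
        rw [norm_norm]; exact ft_bound g ξ)
    refine h2.congr (Eventually.of_forall fun ξ => ?_)
    simp only [pow_one]; ring
  refine ⟨∫ ξ : EE n, ‖ξ‖ * ‖𝓕 (fun x : EE n => (g x : ℂ)) ξ‖ ^ 2, fun ε => ?_⟩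
  refine integral_mono_of_nonneg (Eventually.of_forall fun ξ => by positivity) hi (Eventually.of_forall fun ξ => ?_)
  have : Real.exp (-(4 * π ^ 2 * ε ^ 2) * ‖ξ‖ ^ 2) ≤ 1 := by
    rw [Real.exp_le_one_iff, neg_mul, neg_nonpos]; positivity
  simp only
  calc _ ≤ ‖ξ‖ * 1 * ‖𝓕 (fun x : EE n => (g x : ℂ)) ξ‖ ^ 2 := by gcongr
    _ = _ := by ring

lemma FF_cont {n : ℕ} {X : Type} [TopologicalSpace X] [FirstCountableTopology X] {rep : X → EE n → ℝ} {B : Set (EE n)}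
    [IsFiniteMeasure (volume.restrict B)] (hB : MeasurableSet B)
    (hm : ∀ x, Measurable (rep x)) (h01 : ∀ x y, rep x y ∈ Set.Icc (0:ℝ) 1)
    (hc : ∀ u, MemLp u 2 (volume.restrict B) → Continuous fun x => ∫ y in B, rep x y * u y) {ε : ℝ} (hε : 0 < ε) :
    Continuous fun x => FF ε (B.indicator (rep x)) := by
  have hi : ∀ x, Integrable (rep x) (volume.restrict B) := fun x => int_bdd (hm x) 1 fun y => by
    rw [abs_of_nonneg (h01 x y).1]; exact (h01 x y).2
  have hi' : ∀ x, Integrable (B.indicator (rep x)) := fun x => (integrable_indicator_iff hB).2 (hi x)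
  have hb : ∀ x, ∫ y, |B.indicator (rep x) y| ≤ (volume.restrict B).real Set.univ := by
    intro x
    have e : ∫ y, |B.indicator (rep x) y| = ∫ y in B, |rep x y| := by
      rw [← integral_indicator hB]; congr 1; ext y
      by_cases hy : y ∈ B <;> simp [hy]
    rw [e]
    calc _ ≤ ∫ y in B, (1:ℝ) := integral_mono (hi x).abs (integrable_const _) fun y => by
          simp only
          rw [abs_of_nonneg (h01 x y).1]; exact (h01 x y).2
      _ = _ := by simp
  unfold FF
  refine continuous_of_dominated (bound := fun ξ => ‖ξ‖ * Real.exp (-(4 * π ^ 2 * ε ^ 2) * ‖ξ‖ ^ 2) *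
    ((volume.restrict B).real Set.univ) ^ 2) ?_ ?_ ?_ ?_
  · intro x
    have := ft_cont _ (hi' x)
    fun_prop
  · refine fun x => Eventually.of_forall fun ξ => ?_
    rw [Real.norm_of_nonneg (by positivity)]
    gcongr
    exact (ft_bound _ ξ).trans (hb x)
  · exact (gexp_int' (n := n) (b := 4 * π ^ 2 * ε ^ 2) (by positivity)).mul_const _
  · refine Eventually.of_forall fun ξ => ?_
    have key : Continuous fun x => 𝓕 (fun y : EE n => ((B.indicator (rep x) y : ℝ) : ℂ)) ξ := by
      have e : ∀ x, 𝓕 (fun y : EE n => ((B.indicator (rep x) y : ℝ) : ℂ)) ξ =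
          ((∫ y in B, rep x y * Real.cos (-(2 * π * ⟪y, ξ⟫)) : ℝ) : ℂ) +
          ((∫ y in B, rep x y * Real.sin (-(2 * π * ⟪y, ξ⟫)) : ℝ) : ℂ) * Complex.I := by
        intro x
        have j1 : Integrable (fun y => rep x y * Real.cos (-(2 * π * ⟪y, ξ⟫))) (volume.restrict B) :=
          (hi x).mul_bdd (c := 1) (by fun_prop) (Eventually.of_forall fun y => Real.abs_cos_le_one _)
        have j2 : Integrable (fun y => rep x y * Real.sin (-(2 * π * ⟪y, ξ⟫))) (volume.restrict B) :=
          (hi x).mul_bdd (c := 1) (by fun_prop) (Eventually.of_forall fun y => Real.abs_sin_le_one _)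
        rw [← integral_complex_ofReal, ← integral_complex_ofReal, ← integral_mul_const,
          ← integral_add j1.ofReal (j2.ofReal.mul_const _), Real.fourier_eq, ← integral_indicator hB]
        congr 1; ext y
        by_cases hy : y ∈ B
        · simp only [hy, Set.indicator_of_mem, Circle.smul_def, Real.fourierChar_apply, smul_eq_mul]
          rw [Complex.exp_mul_I]
          push_cast
          simp only [mul_neg]
          ring
        · simp [hy]
      simp_rw [e]
      have k1 := hc (fun y => Real.cos (-(2 * π * ⟪y, ξ⟫))) (memLp_bdd (by fun_prop) 1 fun y => Real.abs_cos_le_one _)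
      have k2 := hc (fun y => Real.sin (-(2 * π * ⟪y, ξ⟫))) (memLp_bdd (by fun_prop) 1 fun y => Real.abs_sin_le_one _)
      exact (Complex.continuous_ofReal.comp k1).add ((Complex.continuous_ofReal.comp k2).mul continuous_const)
    exact continuous_const.mul (key.norm.pow 2)

lemma FF_congr {n : ℕ} (ε : ℝ) {v w : EE n → ℝ} (h : v =ᵐ[volume] w) : FF ε v = FF ε w := by
  have : 𝓕 (fun x : EE n => (v x : ℂ)) = 𝓕 (fun x : EE n => (w x : ℂ)) := by
    ext ξ
    rw [Real.fourier_eq, Real.fourier_eq]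
    refine integral_congr_ae ?_
    filter_upwards [h] with y hy
    rw [hy]
  unfold FF
  rw [this]

lemma smooth_approx {n : ℕ} {A : Set (EE n)} (hA : MeasurableSet A) (hAB : A ⊆ Metric.ball 0 1)
    {δ : ℝ≥0∞} (hδ : δ ≠ 0) :
    ∃ (g : EE n → ℝ) (S : Set (EE n)), ContDiff ℝ (⊤ : ℕ∞) g ∧ HasCompactSupport g ∧
      (∀ y, g y ∈ Set.Icc (0:ℝ) 1) ∧ (∀ y, y ∉ Metric.ball (0 : EE n) 1 → g y = 0) ∧ MeasurableSet S ∧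
      volume S ≤ δ ∧ ∀ y, y ∉ S → g y = A.indicator (fun _ => (1:ℝ)) y := by
  have hfin : volume A ≠ ⊤ := ((measure_mono hAB).trans_lt measure_ball_lt_top).ne
  have hδ2 : δ / 2 ≠ 0 := by simpa using hδ
  obtain ⟨K, hKA, hK, hKs⟩ := hA.exists_isCompact_sdiff_lt hfin hδ2
  obtain ⟨U, hUA, hU, -, hUs⟩ := hA.exists_isOpen_sdiff_lt hfin hδ2
  have hUB : IsOpen (U ∩ Metric.ball (0 : EE n) 1) := hU.inter Metric.isOpen_ball
  obtain ⟨f, hf0, hf1, hf⟩ := exists_contMDiffMap_zero_one_of_isClosed (modelWithCornersSelf ℝ (EE n)) (n := ⊤)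
    hUB.isClosed_compl hK.isClosed (Set.disjoint_left.2 fun y hy hyK =>
      hy ⟨hUA (hKA hyK), hAB (hKA hyK)⟩)
  have hz : ∀ y, y ∉ Metric.ball (0 : EE n) 1 → f y = 0 := fun y hy => hf0 fun h => hy h.2
  refine ⟨f, (A \ K) ∪ (U \ A), f.contMDiff.contDiff, ?_, hf, hz,
    (hA.diff hK.measurableSet).union (hU.measurableSet.diff hA), ?_, ?_⟩
  · refine HasCompactSupport.intro (isCompact_closedBall (0 : EE n) 1) fun y hy => hz y fun h => hy ?_
    exact Metric.ball_subset_closedBall h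
  · refine (measure_union_le _ _).trans ((add_le_add hKs.le hUs.le).trans ?_)
    rw [ENNReal.add_halves]
  · intro y hy
    simp only [Set.mem_union, Set.mem_sdiff, not_or, not_and, not_not] at hy
    by_cases hyA : y ∈ A
    · rw [Set.indicator_of_mem hyA]; exact hf1 (hy.1 hyA)
    · rw [Set.indicator_of_notMem hyA]; exact hf0 fun h => hyA (hy.2 h.1)

section fin
variable {n : ℕ} {X : Type} [TopologicalSpace X] {rep : X → EE n → ℝ}

lemma ind_of_J {B : Set (EE n)} [IsFiniteMeasure (volume.restrict B)] (hB : MeasurableSet B)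
    (hm : ∀ x, Measurable (rep x)) (h01 : ∀ x y, rep x y ∈ Set.Icc (0:ℝ) 1)
    {x : X} (hx : ∀ k : ℕ, ∫ y in B, (rep x y - rep x y ^ 2) < 1 / ((k:ℝ) + 1)) :
    rep x =ᵐ[volume.restrict B] {y | y ∈ B ∧ rep x y = 1}.indicator (fun _ => (1:ℝ)) := by
  have hmx := hm x
  have hnn : ∀ y, 0 ≤ rep x y - rep x y ^ 2 := fun y => by
    have := h01 x y
    nlinarith [this.1, this.2]
  have hle : ∫ y in B, (rep x y - rep x y ^ 2) ≤ 0 :=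
    ge_of_tendsto' tendsto_one_div_add_atTop_nhds_zero_nat fun k => (hx k).le
  have h0 : ∫ y in B, (rep x y - rep x y ^ 2) = 0 := le_antisymm hle (integral_nonneg hnn)
  have hint : Integrable (fun y => rep x y - rep x y ^ 2) (volume.restrict B) :=
    int_bdd (by fun_prop) 1 fun y => by
      rw [abs_of_nonneg (hnn y)]
      nlinarith [(h01 x y).1, (h01 x y).2, sq_nonneg (rep x y)]
  have hae := (integral_eq_zero_iff_of_nonneg hnn hint).1 h0
  filter_upwards [hae, ae_restrict_mem hB] with y hy hyB
  simp only [Pi.zero_apply] at hy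
  by_cases h : rep x y = 1
  · rw [Set.indicator_of_mem (show y ∈ {y | y ∈ B ∧ rep x y = 1} from ⟨hyB, h⟩), h]
  · rw [Set.indicator_of_notMem (fun hh => h hh.2)]
    have : rep x y * (1 - rep x y) = 0 := by linarith
    rcases mul_eq_zero.1 this with h1 | h1
    · exact h1
    · exact absurd (by linarith) h

lemma F_open [FirstCountableTopology X] {B : Set (EE n)}
    [IsFiniteMeasure (volume.restrict B)] (hB : MeasurableSet B)
    (hm : ∀ x, Measurable (rep x)) (h01 : ∀ x y, rep x y ∈ Set.Icc (0:ℝ) 1)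
    (hc : ∀ u, MemLp u 2 (volume.restrict B) → Continuous fun x => ∫ y in B, rep x y * u y) (a b : ℝ) :
    IsOpen {x | ∃ ε, 0 < ε ∧ ε < a ∧ FF ε (B.indicator (rep x)) < |Real.log ε| / b} := by
  have : {x | ∃ ε, 0 < ε ∧ ε < a ∧ FF ε (B.indicator (rep x)) < |Real.log ε| / b} =
    ⋃ (ε : ℝ) (_ : 0 < ε) (_ : ε < a), {x | FF ε (B.indicator (rep x)) < |Real.log ε| / b} := by
    ext x; simp only [Set.mem_setOf_eq, Set.mem_iUnion, exists_prop]
  rw [this]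
  exact isOpen_iUnion fun ε => isOpen_iUnion fun hε => isOpen_iUnion fun _ =>
    isOpen_lt (FF_cont hB hm h01 hc hε) continuous_const

lemma F_dense [BaireSpace X] (i : Fin n) (hm : ∀ x, Measurable (rep x)) (h01 : ∀ x y, rep x y ∈ Set.Icc (0:ℝ) 1)
    (hc : ∀ u, MemLp u 2 (volume.restrict (Metric.ball (0 : EE n) 1)) →
      Continuous fun x => ∫ y in Metric.ball (0 : EE n) 1, rep x y * u y)
    (hmk : ∀ f, Measurable f → (∀ y, f y ∈ Set.Icc (0:ℝ) 1) →
      ∃ x, rep x =ᵐ[volume.restrict (Metric.ball (0 : EE n) 1)] f)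
    (hseq : ∀ (s : ℕ → X) (x : X), (∀ u, MemLp u 2 (volume.restrict (Metric.ball (0 : EE n) 1)) →
      Tendsto (fun m => ∫ y in Metric.ball (0 : EE n) 1, rep (s m) y * u y) atTop
        (𝓝 (∫ y in Metric.ball (0 : EE n) 1, rep x y * u y))) → Tendsto s atTop (𝓝 x)) (a b : ℝ)
    (ha : 0 < a) (hb : 0 < b) :
    Dense {x | ∃ ε, 0 < ε ∧ ε < a ∧ FF ε ((Metric.ball (0 : EE n) 1).indicator (rep x)) < |Real.log ε| / b} := by
  set B := Metric.ball (0 : EE n) 1 with hBdef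
  have hB : MeasurableSet B := Metric.isOpen_ball.measurableSet
  haveI : IsFiniteMeasure (volume.restrict B) := ⟨by simpa using measure_ball_lt_top⟩
  rw [dense_iff_inter_open]
  intro U hU hUne
  have hD : Dense (⋂ k : ℕ, {x | ∫ y in B, (rep x y - rep x y ^ 2) < 1 / ((k:ℝ) + 1)}) :=
    dense_iInter_of_isOpen_nat (fun k => J_open hm h01 hc _)
      (fun k => J_dense i hB hm h01 hmk hseq _ (by positivity))
  obtain ⟨x, hxU, hx⟩ := hD.inter_open_nonempty U hU hUne
  have hx' := ind_of_J hB hm h01 (x := x) (fun k => by simpa using Set.mem_iInter.1 hx k)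
  set A := {y | y ∈ B ∧ rep x y = 1} with hAdef
  have hA : MeasurableSet A := hB.inter (hm x (measurableSet_singleton 1))
  have hap : ∀ m : ℕ, _ := fun m => smooth_approx hA (fun y hy => hy.1) (δ := ((m : ℝ≥0∞) + 1)⁻¹) (by
    simp only [ne_eq, ENNReal.inv_eq_zero]
    exact ENNReal.add_ne_top.2 ⟨ENNReal.natCast_ne_top m, ENNReal.one_ne_top⟩)
  choose g S hg hgs hg01 hg0 hS hSv hgS using hap
  choose z hz using fun m => hmk (g m) (hg m).continuous.measurable (hg01 m)
  have hSt : Tendsto (fun m => (volume.restrict B) (S m)) atTop (𝓝 0) := by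
    have h1 : Tendsto (fun m : ℕ => ((m : ℝ≥0∞) + 1)⁻¹) atTop (𝓝 0) := by
      have := (tendsto_add_atTop_iff_nat 1).2 ENNReal.tendsto_inv_nat_nhds_zero
      simpa using this
    exact tendsto_of_tendsto_of_tendsto_of_le_of_le tendsto_const_nhds h1 (fun _ => zero_le)
      (fun m => (Measure.restrict_apply_le _ _).trans (hSv m))
  have hzx : Tendsto z atTop (𝓝 x) := by
    refine hseq z x fun u hu => ?_
    have hui : Integrable u (volume.restrict B) := hu.integrable (by norm_num)
    have hlim := hui.abs.tendsto_setIntegral_nhds_zero hSt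
    rw [tendsto_iff_norm_sub_tendsto_zero]
    refine squeeze_zero (fun _ => norm_nonneg _) (fun m => ?_) hlim
    have hri : ∀ x, Integrable (fun y => rep x y * u y) (volume.restrict B) := fun x =>
      hui.bdd_mul (c := 1) (hm x).aestronglyMeasurable (Eventually.of_forall fun y => by
        rw [Real.norm_of_nonneg (h01 x y).1]; exact (h01 x y).2)
    rw [← integral_sub (hri _) (hri _), ← integral_indicator (hS m)]
    refine norm_integral_le_of_norm_le (hui.abs.indicator (hS m)) ?_
    filter_upwards [hx', hz m] with y h1 h2
    rw [h1, h2]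
    by_cases hyS : y ∈ S m
    · rw [Set.indicator_of_mem hyS, ← sub_mul, norm_mul]
      have e1 := hg01 m y
      have e2 : A.indicator (fun _ => (1:ℝ)) y ∈ Set.Icc (0:ℝ) 1 := by
        by_cases hyA : y ∈ A <;> simp [hyA]
      have : ‖g m y - A.indicator (fun _ => (1:ℝ)) y‖ ≤ 1 := by
        rw [Real.norm_eq_abs, abs_le]
        constructor <;> linarith [e1.1, e1.2, e2.1, e2.2]
      calc _ ≤ 1 * ‖u y‖ := by gcongr
        _ = |u y| := by rw [one_mul, Real.norm_eq_abs]
    · rw [Set.indicator_of_notMem hyS, hgS m y hyS]; simp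
  obtain ⟨m, hmU⟩ := (hzx.eventually (hU.mem_nhds hxU)).exists
  obtain ⟨C, hC⟩ := FF_smooth (g m) (hg m) (hgs m)
  have hFF : ∀ ε, FF ε (B.indicator (rep (z m))) = FF ε (g m) := by
    intro ε
    refine FF_congr ε ?_
    have := (ae_restrict_iff' hB).1 (hz m)
    filter_upwards [this] with y hy
    by_cases hyB : y ∈ B
    · rw [Set.indicator_of_mem hyB, hy hyB]
    · rw [Set.indicator_of_notMem hyB, hg0 m y hyB]
  have hlog : Tendsto (fun ε : ℝ => |Real.log ε| / b) (𝓝[>] 0) atTop :=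
    (tendsto_abs_atBot_atTop.comp Real.tendsto_log_nhdsGT_zero).atTop_div_const hb
  have hev : ∀ᶠ ε : ℝ in 𝓝[>] 0, ε < a := mem_nhdsWithin_of_mem_nhds (Iio_mem_nhds ha)
  obtain ⟨ε, h1, h2, h3⟩ := ((hlog.eventually_gt_atTop C).and (hev.and self_mem_nhdsWithin)).exists
  exact ⟨z m, hmU, ε, h3, h2, by rw [hFF]; exact (hC ε).trans_lt h1⟩

end fin

/-- for every `n ≥ 1` there is a measurable set `E ⊆ ℝⁿ` of infinite
perimeter with `liminf_{ε→0⁺} (1/|log ε|) ‖γ_ε ∗ 1_E‖_{H^{1/2}}² = 0`. -/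
theorem infinite_perimeter_with_vanishing_liminf (n : ℕ) (hn : 1 ≤ n) :
    ∃ E : Set (EuclideanSpace ℝ (Fin n)), MeasurableSet E ∧ perim E = ⊤ ∧
      Filter.liminf
        (fun ε : ℝ => ENNReal.ofReal |Real.log ε|⁻¹ *
          H12e (conv (gaussSc ε) (E.indicator fun _ => (1 : ℝ))))
        (𝓝[>] (0 : ℝ)) = 0 := by
  let i : Fin n := ⟨0, hn⟩
  set B := Metric.ball (0 : EE n) 1 with hBdef
  have hB : MeasurableSet B := Metric.isOpen_ball.measurableSet
  haveI : IsFiniteMeasure (volume.restrict B) := ⟨by simpa using measure_ball_lt_top⟩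
  obtain ⟨X, _, _, _, _, rep, hm, h01, hc, hmk, hseq⟩ := KW_interface (volume.restrict B)
  let S1 : ℕ → Set X := fun k => {x | ∫ y in B, (rep x y - rep x y ^ 2) < 1 / ((k:ℝ) + 1)}
  let S2 : ℕ → Set X := fun k => {x | ∃ φ : EE n → EE n, Adm φ ∧ (k:ℝ) < ∫ y in B, rep x y * divg φ y}
  let S3 : ℕ → Set X := fun k => {x | ∃ ε, 0 < ε ∧ ε < 1 / ((k:ℝ) + 2) ∧
    FF ε (B.indicator (rep x)) < |Real.log ε| / ((k:ℝ) + 1)}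
  have o1 : ∀ k, IsOpen (S1 k) := fun k => J_open hm h01 hc _
  have o2 : ∀ k, IsOpen (S2 k) := fun k => P_open hc _
  have o3 : ∀ k, IsOpen (S3 k) := fun k => F_open hB hm h01 hc _ _
  have d1 : ∀ k, Dense (S1 k) := fun k => J_dense i hB hm h01 hmk hseq _ (by positivity)
  have d2 : ∀ k, Dense (S2 k) := fun k => P_dense i hm h01 hmk hseq _
  have d3 : ∀ k, Dense (S3 k) := fun k => F_dense i hm h01 hc hmk hseq _ _ (by positivity) (by positivity)
  have hD : Dense (⋂ k, (S1 k ∩ (S2 k ∩ S3 k))) := dense_iInter_of_isOpen_nat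
    (fun k => (o1 k).inter ((o2 k).inter (o3 k)))
    (fun k => (d1 k).inter_of_isOpen_left ((d2 k).inter_of_isOpen_left (d3 k) (o2 k)) (o1 k))
  obtain ⟨x, hx⟩ := hD.nonempty
  have hx := fun k => Set.mem_iInter.1 hx k
  have hx' := ind_of_J hB hm h01 (x := x) (fun k => (hx k).1)
  set A := {y | y ∈ B ∧ rep x y = 1} with hAdef
  have hAB : A ⊆ B := fun y hy => hy.1
  have hA : MeasurableSet A := hB.inter (hm x (measurableSet_singleton 1))
  have hae : B.indicator (rep x) =ᵐ[volume] A.indicator (fun _ => (1:ℝ)) := by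
    have := (ae_restrict_iff' hB).1 hx'
    filter_upwards [this] with y hy
    by_cases hyB : y ∈ B
    · rw [Set.indicator_of_mem hyB, hy hyB]
    · rw [Set.indicator_of_notMem hyB, Set.indicator_of_notMem (fun h => hyB (hAB h))]
  refine ⟨A, hA, ?_, ?_⟩
  · refine ENNReal.eq_top_of_forall_nnreal_le fun r => ?_
    obtain ⟨k, hk⟩ := exists_nat_ge (r : ℝ)
    obtain ⟨φ, hφ, hlt⟩ := (hx k).2.1
    have e : ∫ y in B, rep x y * divg φ y = ∫ y in A, divg φ y := by
      rw [← integral_indicator hB, ← integral_indicator hA]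
      refine integral_congr_ae ?_
      filter_upwards [hae] with y hy
      by_cases hyA : y ∈ A
      · have hyB := hAB hyA
        rw [Set.indicator_of_mem hyB, Set.indicator_of_mem hyA] at hy
        rw [Set.indicator_of_mem hyB, Set.indicator_of_mem hyA, hy, one_mul]
      · rw [Set.indicator_of_notMem hyA] at hy ⊢
        by_cases hyB : y ∈ B
        · rw [Set.indicator_of_mem hyB] at hy ⊢
          rw [hy, zero_mul]
        · rw [Set.indicator_of_notMem hyB]
    rw [e] at hlt
    have h1 : (r : ℝ≥0∞) ≤ ENNReal.ofReal (∫ y in A, divg φ y) := by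
      rw [← ENNReal.ofReal_coe_nnreal]
      exact ENNReal.ofReal_le_ofReal (hk.trans hlt.le)
    refine h1.trans ?_
    unfold perim
    exact le_iSup_of_le φ (le_iSup_of_le hφ.1 (le_iSup_of_le hφ.2.1 (le_iSup_of_le hφ.2.2 le_rfl)))
  · have hAi : Integrable (A.indicator (fun _ => (1:ℝ)) : EE n → ℝ) := by
      rw [integrable_indicator_iff hA]
      exact integrableOn_const ((measure_mono hAB).trans_lt measure_ball_lt_top).ne
    have key : ∀ k : ℕ, Filter.liminf
        (fun ε : ℝ => ENNReal.ofReal |Real.log ε|⁻¹ *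
          H12e (conv (gaussSc ε) (A.indicator fun _ => (1 : ℝ)))) (𝓝[>] (0 : ℝ)) ≤ ((k : ℝ≥0∞))⁻¹ := by
      intro k
      refine Filter.liminf_le_of_frequently_le' ?_
      rw [frequently_nhdsWithin_iff, Metric.nhds_basis_ball.frequently_iff]
      intro δ hδ
      obtain ⟨N, hN⟩ := exists_nat_one_div_lt hδ
      obtain ⟨ε, hε, hε2, hF⟩ := (hx (max N k)).2.2
      have hM : ((N:ℝ)) ≤ ((max N k : ℕ) : ℝ) := by exact_mod_cast le_max_left N k
      have hM' : ((k:ℝ)) ≤ ((max N k : ℕ) : ℝ) := by exact_mod_cast le_max_right N k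
      set M : ℝ := ((max N k : ℕ) : ℝ)
      have hM0 : 0 ≤ M := le_trans (Nat.cast_nonneg _) hM
      have hεδ : ε < δ := by
        refine hε2.trans (lt_of_le_of_lt ?_ hN)
        exact one_div_le_one_div_of_le (by positivity) (by linarith)
      have hε1 : ε < 1 := by
        refine hε2.trans_le ?_
        rw [div_le_one (by positivity)]; linarith
      refine ⟨ε, by simpa [abs_of_pos hε] using hεδ, ?_, hε⟩
      have hl : 0 < |Real.log ε| := abs_pos.2 (Real.log_neg hε hε1).ne
      rw [H12_eq hε _ hAi, ← FF_congr ε hae, ← ENNReal.ofReal_mul (by positivity)]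
      have hq : |Real.log ε|⁻¹ * FF ε (B.indicator (rep x)) ≤ (M + 1)⁻¹ := by
        rw [inv_mul_le_iff₀ hl, ← div_eq_mul_inv]
        exact hF.le
      refine (ENNReal.ofReal_le_ofReal hq).trans ?_
      rw [ENNReal.ofReal_inv_of_pos (by positivity), ENNReal.inv_le_inv, ← ENNReal.ofReal_natCast]
      exact ENNReal.ofReal_le_ofReal (by linarith)
    exact le_antisymm (ge_of_tendsto' ENNReal.tendsto_inv_nat_nhds_zero key) zero_le
end
end

section
/- Let E ⊂ [0,1] be a measurable set and let E^n = E × ⋯ × E ⊂ R^n be its n-fold Cartesian product. Then for every ε > 0, ‖γ_ε ∗ 1_{E^n}‖_{H^{1/2}(R^n)}^2 ≤ n · ‖γ_ε ∗ 1_E‖_{H^{1/2}(R)}^2, where on the left γ_ε is the scaled standard Gaussian on R^n and on the right it is the scaled standard Gaussian on R. -/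
open MeasureTheory Filter Topology Real
open scoped FourierTransform RealInnerProductSpace ENNReal

noncomputable section

variable {V : Type*} [NormedAddCommGroup V] [InnerProductSpace ℝ V]
  [FiniteDimensional ℝ V] [MeasurableSpace V] [BorelSpace V] [MeasureSpace V]

open scoped Convolution

theorem aux_planch (f : ℝ → ℂ) (h1 : Integrable f) (h2 : MemLp f 2) :
    ∫⁻ ξ, (‖𝓕 f ξ‖₊ : ℝ≥0∞) ^ 2 = ∫⁻ x, (‖f x‖₊ : ℝ≥0∞) ^ 2 := by
  have hc : Continuous (𝓕 f) :=
    VectorFourier.fourierIntegral_continuous Real.continuous_fourierChar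
      (by exact continuous_inner) h1
  set F : Lp ℂ 2 (volume : Measure ℝ) := h2.toLp f with hF
  have key : ∀ᵐ x, 𝓕 f x = (𝓕 F : Lp ℂ 2 (volume : Measure ℝ)) x := by
    apply ae_eq_of_integral_contDiff_smul_eq hc.locallyIntegrable
      ((Lp.memLp _).locallyIntegrable (by norm_num))
    intro g gs gc
    have hg₁ : HasCompactSupport (Complex.ofRealCLM ∘ g) := gc.comp_left rfl
    have hg₂ : ContDiff ℝ (⊤ : ℕ∞) (Complex.ofRealCLM ∘ g) := by fun_prop
    set G := hg₁.toSchwartzMap hg₂ with hG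
    have e1 : ∫ x, g x • (𝓕 F : Lp ℂ 2 (volume : Measure ℝ)) x
        = Lp.toTemperedDistribution (𝓕 F : Lp ℂ 2 (volume : Measure ℝ)) G := by
      rw [Lp.toTemperedDistribution_apply]
      simp [hG]
    rw [e1, ← Lp.fourier_toTemperedDistribution_eq, TemperedDistribution.fourier_apply,
      Lp.toTemperedDistribution_apply]
    have e2 : ∫ x, g x • 𝓕 f x = ∫ x, 𝓕 f x • G x := by
      congr 1; ext x; simp [hG, mul_comm]
    have e3 : ∫ x, (𝓕 G : SchwartzMap ℝ ℂ) x • F x = ∫ x, f x • 𝓕 (G : ℝ → ℂ) x := by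
      apply integral_congr_ae
      filter_upwards [h2.coeFn_toLp] with x hx
      rw [hF, hx, SchwartzMap.fourier_coe]; simp [mul_comm]
    rw [e2, e3]
    have := VectorFourier.integral_fourierIntegral_smul_eq_flip (L := innerₗ ℝ)
      (μ := (volume : Measure ℝ)) (ν := (volume : Measure ℝ)) (f := f) (g := (G : ℝ → ℂ))
      Real.continuous_fourierChar (by exact continuous_inner) h1 G.integrable
    rw [flip_innerₗ] at this
    exact this
  have e4 : eLpNorm (𝓕 f) 2 volume = eLpNorm f 2 volume := by
    rw [eLpNorm_congr_ae key, ← eLpNorm_congr_ae h2.coeFn_toLp]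
    have := Lp.norm_fourier_eq F
    rw [Lp.norm_def, Lp.norm_def] at this
    exact (ENNReal.toReal_eq_toReal_iff' (Lp.eLpNorm_ne_top _) (Lp.eLpNorm_ne_top _)).1 this
  have e5 := congrArg (fun t : ℝ≥0∞ => t ^ 2) e4
  have h0 : ∀ u : ℝ → ℂ, (eLpNorm u 2 volume) ^ 2 = ∫⁻ ξ, (‖u ξ‖₊ : ℝ≥0∞) ^ 2 := by
    intro u
    have := eLpNorm_nnreal_pow_eq_lintegral (f := u) (μ := (volume : Measure ℝ))
      (p := 2) (by norm_num)
    simpa [enorm_eq_nnnorm] using this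
  simpa only [h0] using e5

theorem aux_lint {n : ℕ} (f : Fin n → ℝ → ℝ≥0∞) (hf : ∀ i, Measurable (f i)) :
    ∫⁻ x : Fin n → ℝ, ∏ i, f i (x i) = ∏ i, ∫⁻ x, f i x := by
  induction n with
  | zero => simp [volume_pi]
  | succ n ih =>
    rw [← ((volume_preserving_piFinSuccAbove (fun _ : Fin (n+1) => ℝ) 0).symm).lintegral_comp_emb
      (MeasurableEquiv.measurableEmbedding _)]
    simp_rw [MeasurableEquiv.piFinSuccAbove_symm_apply, Fin.insertNthEquiv,
            Fin.prod_univ_succ, Fin.insertNth_zero, Equiv.coe_fn_mk, Fin.cons_succ,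
            Fin.cons_zero]
    rw [← ih _ (fun i => hf i.succ)]
    exact lintegral_prod_mul (μ := (volume : Measure ℝ))
      (ν := (volume : Measure (Fin n → ℝ))) (f := f 0) (g := fun y : Fin n → ℝ => ∏ i, f i.succ (y i))
      (hf 0).aemeasurable
      (Finset.measurable_fun_prod _ fun i _ => (hf i.succ).comp (measurable_pi_apply i)).aemeasurable

theorem aux_eint {n : ℕ} (f : Fin n → ℝ → ℂ) :
    ∫ x : EuclideanSpace ℝ (Fin n), ∏ i, f i (x i) = ∏ i, ∫ x, f i x := by
  rw [← integral_fintype_prod_volume_eq_prod,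
    ← (PiLp.volume_preserving_ofLp (Fin n)).integral_comp
      (MeasurableEquiv.toLp 2 (Fin n → ℝ)).symm.measurableEmbedding]

theorem aux_eintR {n : ℕ} (f : Fin n → ℝ → ℝ) :
    ∫ x : EuclideanSpace ℝ (Fin n), ∏ i, f i (x i) = ∏ i, ∫ x, f i x := by
  rw [← integral_fintype_prod_volume_eq_prod,
    ← (PiLp.volume_preserving_ofLp (Fin n)).integral_comp
      (MeasurableEquiv.toLp 2 (Fin n → ℝ)).symm.measurableEmbedding]

theorem aux_elint {n : ℕ} (f : Fin n → ℝ → ℝ≥0∞) (hf : ∀ i, Measurable (f i)) :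
    ∫⁻ x : EuclideanSpace ℝ (Fin n), ∏ i, f i (x i) = ∏ i, ∫⁻ x, f i x := by
  rw [← aux_lint f hf,
    ← (PiLp.volume_preserving_ofLp (Fin n)).lintegral_comp_emb
      (MeasurableEquiv.toLp 2 (Fin n → ℝ)).symm.measurableEmbedding]

theorem aux_gauss {n : ℕ} (ε : ℝ) (x : EuclideanSpace ℝ (Fin n)) :
    gaussSc ε x = ∏ i, gaussSc ε (x i) := by
  simp only [gaussSc, scaleFn, gauss, finrank_euclideanSpace_fin, Module.finrank_self,
    Finset.prod_mul_distrib, Finset.prod_const, Finset.card_univ, Fintype.card_fin, pow_one]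
  rw [← Real.exp_sum, ← Real.rpow_natCast ((2 * π) ^ _), ← Real.rpow_mul (by positivity),
    EuclideanSpace.norm_sq_eq]
  congr 3
  · push_cast; ring
  · rw [← Finset.sum_neg_distrib, Finset.sum_div]; simp

theorem aux_gauss1 (ε : ℝ) (hε : 0 < ε) :
    (gaussSc ε : ℝ → ℝ) = ProbabilityTheory.gaussianPDFReal 0 (ε.toNNReal ^ 2) := by
  ext x
  simp only [gaussSc, scaleFn, gauss, Module.finrank_self, ProbabilityTheory.gaussianPDFReal]
  simp only [NNReal.coe_pow, Real.coe_toNNReal ε hε.le, smul_eq_mul, norm_mul, norm_inv, Real.norm_eq_abs,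
    mul_pow, inv_pow, sq_abs, pow_one, sub_zero]
  rw [Real.sqrt_mul (by positivity), Real.sqrt_sq hε.le, mul_inv, Real.sqrt_eq_rpow,
    ← Real.rpow_neg (by positivity), ← mul_assoc, mul_comm ε⁻¹]
  congr 2
  · norm_num
  · field_simp

theorem aux_conv {n : ℕ} (E : Set ℝ) (ε : ℝ) (x : EuclideanSpace ℝ (Fin n)) :
    conv (gaussSc ε)
        (Set.indicator {x : EuclideanSpace ℝ (Fin n) | ∀ i, x i ∈ E} fun _ => (1 : ℝ)) x
      = ∏ i, conv (gaussSc ε) (E.indicator fun _ => (1 : ℝ)) (x i) := by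
  unfold conv
  rw [← aux_eintR]
  congr 1; ext y
  rw [aux_gauss, Finset.prod_mul_distrib]
  congr 1
  by_cases h : ∀ i, x i - y i ∈ E
  · rw [Set.indicator_of_mem (by simpa using h)]
    simp [h]
  · rw [Set.indicator_of_notMem (by simpa using h)]
    push Not at h
    obtain ⟨i, hi⟩ := h
    rw [Finset.prod_eq_zero (Finset.mem_univ i)]
    simp [hi]

theorem aux_fourier {n : ℕ} (f : ℝ → ℝ) (ξ : EuclideanSpace ℝ (Fin n)) :
    𝓕 (fun x : EuclideanSpace ℝ (Fin n) => ((∏ i, f (x i) : ℝ) : ℂ)) ξ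
      = ∏ i, 𝓕 (fun x : ℝ => (f x : ℂ)) (ξ i) := by
  simp only [Real.fourier_eq']
  refine Eq.trans ?_ (aux_eint (fun i v =>
    Complex.exp ((↑(-2 * π * inner ℝ v (ξ i)) * Complex.I)) • (f v : ℂ)))
  congr 1; ext x
  simp only [smul_eq_mul, Finset.prod_mul_distrib]
  rw [← Complex.exp_sum, PiLp.inner_apply]
  push_cast
  rw [Finset.mul_sum, Finset.sum_mul]

theorem aux_L2 (E : Set ℝ) (hE : MeasurableSet E)
    (hE1 : E ⊆ Set.Icc 0 1) (ε : ℝ) (hε : 0 < ε) :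
    Continuous (𝓕 (fun x => (conv (gaussSc ε) (E.indicator fun _ => (1 : ℝ)) x : ℂ))) ∧
    ∫⁻ ξ, (‖𝓕 (fun x => (conv (gaussSc ε) (E.indicator fun _ => (1 : ℝ)) x : ℂ)) ξ‖₊ : ℝ≥0∞) ^ 2
      ≤ 1 := by
  set f : ℝ → ℝ := conv (gaussSc ε) (E.indicator fun _ => (1 : ℝ)) with hf
  have hv : (ε.toNNReal ^ 2) ≠ 0 := by
    apply pow_ne_zero; simpa using hε
  have gI : Integrable (gaussSc ε : ℝ → ℝ) := by
    rw [aux_gauss1 ε hε]; exact ProbabilityTheory.integrable_gaussianPDFReal _ _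
  have g1 : ∫ x : ℝ, gaussSc ε x = 1 := by
    rw [aux_gauss1 ε hε]; exact ProbabilityTheory.integral_gaussianPDFReal_eq_one _ hv
  have g0 : ∀ x : ℝ, 0 ≤ gaussSc ε x := by
    intro x; rw [aux_gauss1 ε hε]; exact ProbabilityTheory.gaussianPDFReal_nonneg _ _ _
  have hEv : volume E ≤ 1 := (measure_mono hE1).trans (by simp)
  have iI : Integrable (E.indicator fun _ => (1 : ℝ)) := by
    rw [integrable_indicator_iff hE]
    exact integrableOn_const (hEv.trans_lt ENNReal.one_lt_top).ne
  have hconv : f = (gaussSc ε) ⋆[ContinuousLinearMap.mul ℝ ℝ, volume]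
      (E.indicator fun _ => (1 : ℝ)) := rfl
  have fI : Integrable f := by rw [hconv]; exact gI.integrable_convolution _ iI
  have fint : ∫ x, f x ≤ 1 := by
    rw [hconv, integral_convolution _ gI iI, g1, integral_indicator hE]
    simp only [integral_const, measureReal_restrict_apply_univ, smul_eq_mul, mul_one,
      ContinuousLinearMap.mul_apply', one_mul]
    exact ENNReal.toReal_le_of_le_ofReal zero_le_one (by simpa using hEv)
  have f0 : ∀ x, 0 ≤ f x := fun x => integral_nonneg fun y =>
    mul_nonneg (g0 y) (Set.indicator_nonneg (fun _ _ => zero_le_one) _)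
  have f1 : ∀ x, f x ≤ 1 := by
    intro x
    rw [← g1]
    apply integral_mono_of_nonneg _ gI
    · filter_upwards with y
      exact mul_le_of_le_one_right (g0 y) (Set.indicator_le_self' (fun _ _ => zero_le_one) _ |>.trans le_rfl)
    · filter_upwards with y
      exact mul_nonneg (g0 y) (Set.indicator_nonneg (fun _ _ => zero_le_one) _)
  have fcI : Integrable (fun x => (f x : ℂ)) := fI.ofReal
  have fn : ∀ x, ‖(f x : ℂ)‖ ≤ 1 := by
    intro x; rw [Complex.norm_real, Real.norm_of_nonneg (f0 x)]; exact f1 x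
  have f2 : MemLp (fun x => (f x : ℂ)) 2 := by
    rw [memLp_two_iff_integrable_sq_norm fcI.aestronglyMeasurable]
    refine fI.mono (fcI.aestronglyMeasurable.norm.pow 2) (Eventually.of_forall fun x => ?_)
    rw [Complex.norm_real, norm_pow, norm_norm, sq]
    refine mul_le_of_le_one_left (norm_nonneg _) ?_
    rw [Real.norm_of_nonneg (f0 x)]; exact f1 x
  refine ⟨VectorFourier.fourierIntegral_continuous Real.continuous_fourierChar
      (by exact continuous_inner) fcI, ?_⟩
  rw [aux_planch _ fcI f2]
  calc ∫⁻ x, (‖(f x : ℂ)‖₊ : ℝ≥0∞) ^ 2 ≤ ∫⁻ x, ENNReal.ofReal (f x) := by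
        apply lintegral_mono
        intro x
        have : (‖(f x : ℂ)‖₊ : ℝ≥0∞) = ENNReal.ofReal (f x) := by
          rw [← enorm_eq_nnnorm, ← ofReal_norm, Complex.norm_real,
            Real.norm_of_nonneg (f0 x)]
        simp only [this]
        rw [sq]
        exact mul_le_of_le_one_left zero_le (by simpa using f1 x)
    _ = ENNReal.ofReal (∫ x, f x) := (ofReal_integral_eq_lintegral_ofReal fI
        (Eventually.of_forall f0)).symm
    _ ≤ 1 := by simpa using fint

theorem aux_norm {n : ℕ} (ξ : EuclideanSpace ℝ (Fin n)) :
    (‖ξ‖₊ : ℝ≥0∞) ≤ ∑ i, (‖ξ i‖₊ : ℝ≥0∞) := by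
  rw [← ENNReal.ofNNReal_finsetSum, ENNReal.coe_le_coe, ← NNReal.coe_le_coe]
  push_cast
  rw [EuclideanSpace.norm_eq]
  refine Real.sqrt_le_iff.2 ⟨Finset.sum_nonneg fun _ _ => norm_nonneg _, ?_⟩
  exact Finset.sum_sq_le_sq_sum_of_nonneg fun _ _ => norm_nonneg _

/-- for `E ⊆ [0,1]` and its `n`-fold product `Eⁿ ⊆ ℝⁿ`,
`‖γ_ε ∗ 1_{Eⁿ}‖_{H^{1/2}(ℝⁿ)}² ≤ n ‖γ_ε ∗ 1_E‖_{H^{1/2}(ℝ)}²` for every `ε > 0`. -/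
theorem H12_of_product_set_le (n : ℕ) (E : Set ℝ) (hE : MeasurableSet E)
    (hE1 : E ⊆ Set.Icc 0 1) (ε : ℝ) (hε : 0 < ε) :
    H12e (conv (gaussSc ε)
        (Set.indicator {x : EuclideanSpace ℝ (Fin n) | ∀ i, x i ∈ E} fun _ => (1 : ℝ)))
      ≤ (n : ℝ≥0∞) * H12e (conv (gaussSc ε) (E.indicator fun _ => (1 : ℝ))) := by
  obtain ⟨hc, h1⟩ := aux_L2 E hE hE1 ε hε
  unfold H12e
  simp only [aux_conv]
  simp only [aux_fourier]
  set F := 𝓕 (fun x => (conv (gaussSc ε) (E.indicator fun _ => (1 : ℝ)) x : ℂ)) with hF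
  let w : ℝ → ℝ≥0∞ := fun t => (‖F t‖₊ : ℝ≥0∞) ^ 2
  have hw : Measurable w := (hc.measurable.nnnorm.coe_nnreal_ennreal).pow_const 2
  let k : Fin n → Fin n → ℝ → ℝ≥0∞ := fun i j t => if j = i then (‖t‖₊ : ℝ≥0∞) * w t else w t
  have hk : ∀ i j, Measurable (k i j) := by
    intro i j
    by_cases h : j = i
    · simp only [k, h, if_true]; exact (measurable_nnnorm.coe_nnreal_ennreal).mul hw
    · simp only [k, h, if_false]; exact hw
  calc _ ≤ ∫⁻ ξ : EuclideanSpace ℝ (Fin n), ∑ i, ∏ j, k i j (ξ j) := by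
        apply lintegral_mono
        intro ξ
        simp only [nnnorm_prod, ENNReal.ofNNReal_finsetProd, ← Finset.prod_pow]
        refine (mul_le_mul_left (aux_norm ξ) _).trans (le_of_eq ?_)
        rw [Finset.sum_mul]
        refine Finset.sum_congr rfl fun i _ => ?_
        rw [← Finset.mul_prod_erase _ _ (Finset.mem_univ i),
          ← Finset.mul_prod_erase _ (fun j => k i j (ξ j)) (Finset.mem_univ i), ← mul_assoc]
        congr 1
        · simp [k, w]
        · refine Finset.prod_congr rfl fun j hj => ?_
          simp [k, w, Finset.ne_of_mem_erase hj]
    _ = ∑ i, ∏ j, ∫⁻ t, k i j t := by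
        rw [lintegral_finsetSum]
        · exact Finset.sum_congr rfl fun i _ => aux_elint _ (hk i)
        · intro i _
          refine Finset.measurable_fun_prod _ fun j _ => (hk i j).comp ?_
          fun_prop
    _ ≤ ∑ i : Fin n, ∫⁻ t, (‖t‖₊ : ℝ≥0∞) * w t := by
        refine Finset.sum_le_sum fun i _ => ?_
        rw [← Finset.mul_prod_erase _ _ (Finset.mem_univ i)]
        simp only [k, if_true]
        refine mul_le_of_le_one_right zero_le (Finset.prod_le_one' fun j hj => ?_)
        simp only [Finset.ne_of_mem_erase hj, if_false]
        exact h1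
    _ = _ := by simp [w]
end
end

section
/- Let (φ_k)_{k≥1} be a compatible sequence with scales (ε_k). Then there exists a measurable set E ⊂ [0,1] with 0 < |E| < 1 such that φ_k → 1_E in L^p for every p < ∞ and lim_{k→∞} (1/|log ε_k|) ‖γ_{ε_k} ∗ 1_E‖_{H^{1/2}}^2 = 0. -/
open MeasureTheory Filter Topology Real
open scoped FourierTransform RealInnerProductSpace ENNReal

noncomputable section

variable {V : Type*} [NormedAddCommGroup V] [InnerProductSpace ℝ V]
  [FiniteDimensional ℝ V] [MeasurableSpace V] [BorelSpace V] [MeasureSpace V]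

lemma aux_ft_ae (u : ℝ → ℂ) (hu1 : Integrable u) (hu2 : MemLp u 2) :
    (𝓕 u) =ᵐ[volume] (𝓕 (hu2.toLp u) : Lp ℂ 2 (volume : Measure ℝ)) := by
  have hcont : Continuous (𝓕 u) :=
    VectorFourier.fourierIntegral_continuous Real.continuous_fourierChar
      (by fun_prop) hu1
  refine ae_eq_of_integral_contDiff_smul_eq hcont.locallyIntegrable
    ((Lp.memLp _).locallyIntegrable (by norm_num)) ?_
  intro g hg hgs
  have hgs' : HasCompactSupport (fun x => (g x : ℂ)) := hgs.comp_left Complex.ofReal_zero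
  let G : SchwartzMap ℝ ℂ := hgs'.toSchwartzMap (Complex.ofRealCLM.contDiff.comp hg)
  have hG : ∀ x, G x = (g x : ℂ) := fun x => rfl
  have h1 := congrArg (fun T : TemperedDistribution ℝ ℂ => T G)
    (MeasureTheory.Lp.fourier_toTemperedDistribution_eq (hu2.toLp u))
  simp only [TemperedDistribution.fourier_apply, Lp.toTemperedDistribution_apply] at h1
  have h2 : ∫ x, (𝓕 G) x • (hu2.toLp u) x = ∫ x, (𝓕 G) x • u x := by
    apply integral_congr_ae
    filter_upwards [hu2.coeFn_toLp] with x hx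
    rw [hx]
  have h3 : ∫ x, (𝓕 (G : ℝ → ℂ)) x • u x = ∫ x, G x • (𝓕 u) x :=
    VectorFourier.integral_fourierIntegral_smul_eq_flip (L := innerₗ ℝ)
      Real.continuous_fourierChar (by fun_prop) G.integrable hu1 |>.trans (by
        simp only [flip_innerₗ]; rfl)
  rw [h2, SchwartzMap.fourier_coe, h3] at h1
  simpa [hG] using h1

lemma aux_sq_lint {u : ℝ → ℂ} : ∫⁻ x, ‖u x‖ₑ ^ 2 = eLpNorm u 2 volume ^ 2 := by
  have := eLpNorm_nnreal_pow_eq_lintegral (f := u) (μ := (volume : Measure ℝ)) (p := 2) (by norm_num)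
  simp only [NNReal.coe_ofNat, ENNReal.coe_ofNat, ENNReal.rpow_ofNat] at this
  exact this.symm

lemma aux_planch_s3 (u : ℝ → ℂ) (hu1 : Integrable u) :
    ∫⁻ x, ‖𝓕 u x‖ₑ ^ 2 ≤ eLpNorm u 2 volume ^ 2 := by
  by_cases h : eLpNorm u 2 volume = ⊤
  · simp [h]
  have hu2 : MemLp u 2 := ⟨hu1.1, lt_top_iff_ne_top.2 h⟩
  rw [aux_sq_lint, eLpNorm_congr_ae (aux_ft_ae u hu1 hu2)]
  have := MeasureTheory.Lp.norm_fourier_eq (hu2.toLp u)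
  rw [Lp.norm_def, Lp.norm_def, ENNReal.toReal_eq_toReal_iff' (Lp.eLpNorm_ne_top _) (Lp.eLpNorm_ne_top _)] at this
  rw [this, eLpNorm_congr_ae hu2.coeFn_toLp]

lemma aux_gauss_eq (r : ℝ) (hr : 0 < r) (x : ℝ) :
    gaussSc r x = (r⁻¹ * (2 * π) ^ (-(1:ℝ) / 2)) * Real.exp (-(1 / (2 * r ^ 2)) * x ^ 2) := by
  simp only [gaussSc, scaleFn, gauss, Module.finrank_self, pow_one, Nat.cast_one, smul_eq_mul,
    norm_mul, mul_pow, Real.norm_eq_abs, sq_abs]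
  rw [mul_assoc]
  congr 3
  field_simp

lemma aux_gauss_int (r : ℝ) (hr : 0 < r) : Integrable (gaussSc r : ℝ → ℝ) := by
  have : (gaussSc r : ℝ → ℝ) = _ := funext (aux_gauss_eq r hr)
  rw [this]
  exact (integrable_exp_neg_mul_sq (by positivity)).const_mul _

lemma aux_gauss_cont (r : ℝ) (hr : 0 < r) : Continuous (gaussSc r : ℝ → ℝ) := by
  have : (gaussSc r : ℝ → ℝ) = _ := funext (aux_gauss_eq r hr)
  rw [this]
  fun_prop

lemma aux_gauss_ft (r : ℝ) (hr : 0 < r) (ξ : ℝ) :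
    ‖𝓕 (fun x : ℝ => ((gaussSc r x : ℝ) : ℂ)) ξ‖ = Real.exp (-(2 * π ^ 2 * r ^ 2 * ξ ^ 2)) := by
  have hb : 0 < ((1 / (2 * r ^ 2) : ℝ) : ℂ).re := by
    rw [Complex.ofReal_re]; positivity
  have h := fourier_gaussian_innerProductSpace (V := ℝ) hb ξ
  have e : (fun x : ℝ => ((gaussSc r x : ℝ) : ℂ)) =
      ((r⁻¹ * (2 * π) ^ (-(1:ℝ) / 2) : ℝ) : ℂ) • (fun v : ℝ => Complex.exp (-((1 / (2 * r ^ 2) : ℝ) : ℂ) * ‖v‖ ^ 2)) := by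
    ext x
    rw [aux_gauss_eq r hr]
    simp only [Pi.smul_apply, smul_eq_mul]
    rw [Complex.ofReal_mul, Complex.ofReal_exp]
    congr 2
    rw [← Complex.ofReal_pow ‖x‖, Real.norm_eq_abs, sq_abs]
    push_cast; ring
  have hs : ∀ (c : ℂ) (F : ℝ → ℂ), 𝓕 (c • F) ξ = c • 𝓕 F ξ := fun c F =>
    congrFun (VectorFourier.fourierIntegral_const_smul _ _ _ F c) ξ
  rw [e, hs, h, Module.finrank_self, smul_eq_mul, norm_mul, norm_mul]
  have e2 : ((π : ℂ) / ((1 / (2 * r ^ 2) : ℝ) : ℂ)) ^ (((1 : ℕ) : ℂ) / 2) = (((2 * π) ^ ((1:ℝ)/2) * r : ℝ) : ℂ) := by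
    have : ((π : ℂ) / ((1 / (2 * r ^ 2) : ℝ) : ℂ)) = ((2 * π * r ^ 2 : ℝ) : ℂ) := by
      push_cast; field_simp
    rw [this, show (((1 : ℕ) : ℂ) / 2) = (((1:ℝ)/2 : ℝ) : ℂ) by push_cast; rfl, ← Complex.ofReal_cpow (by positivity),
      Real.mul_rpow (by positivity) (by positivity), ← Real.sqrt_eq_rpow (r ^ 2), Real.sqrt_sq hr.le]
  have e3 : (-(π : ℂ) ^ 2 * (‖ξ‖ : ℂ) ^ 2 / ((1 / (2 * r ^ 2) : ℝ) : ℂ)) = ((-(2 * π ^ 2 * r ^ 2 * ξ ^ 2) : ℝ) : ℂ) := by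
    rw [← Complex.ofReal_pow ‖ξ‖, Real.norm_eq_abs, sq_abs]
    push_cast; field_simp
  rw [e2, e3, ← Complex.ofReal_exp, Complex.norm_real, Complex.norm_real, Complex.norm_real,
    Real.norm_of_nonneg (by positivity), Real.norm_of_nonneg (by positivity), Real.norm_of_nonneg (by positivity)]
  have : (2 * π) ^ (-(1:ℝ) / 2) * (2 * π) ^ ((1:ℝ) / 2) = 1 := by
    rw [← Real.rpow_add (by positivity)]; norm_num
  calc _ = (r⁻¹ * r) * ((2 * π) ^ (-(1:ℝ) / 2) * (2 * π) ^ ((1:ℝ) / 2)) * Real.exp (-(2 * π ^ 2 * r ^ 2 * ξ ^ 2)) := by ring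
    _ = _ := by rw [this, inv_mul_cancel₀ hr.ne']; ring

lemma aux_conv_eq (f g : ℝ → ℝ) :
    (fun x => (conv f g x : ℂ)) =
      MeasureTheory.convolution (fun x => (f x : ℂ)) (fun x => (g x : ℂ)) (ContinuousLinearMap.mul ℂ ℂ) volume := by
  ext x
  simp only [conv, MeasureTheory.convolution, ContinuousLinearMap.mul_apply']
  rw [← integral_complex_ofReal]
  simp

lemma aux_conv_int {f g : ℝ → ℝ} (hf : Integrable f) (hg : Integrable g) :
    Integrable (fun x => (conv f g x : ℂ)) := by
  rw [aux_conv_eq]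
  exact hf.ofReal.integrable_convolution _ hg.ofReal

lemma aux_conv_ft {f g : ℝ → ℝ} (hf : Integrable f) (hg : Integrable g) (ξ : ℝ) :
    𝓕 (fun x => (conv f g x : ℂ)) ξ = 𝓕 (fun x => (f x : ℂ)) ξ * 𝓕 (fun x => (g x : ℂ)) ξ := by
  rw [aux_conv_eq]
  exact Real.fourier_mul_convolution_eq hf.ofReal hg.ofReal ξ

lemma aux_ft_cont {u : ℝ → ℂ} (hu : Integrable u) : Continuous (𝓕 u) :=
  VectorFourier.fourierIntegral_continuous Real.continuous_fourierChar (by fun_prop) hu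

lemma aux_real_ineq (r : ℝ) (hr : 0 < r) (ξ h : ℝ) :
    |ξ| * (Real.exp (-(2 * π ^ 2 * r ^ 2 * ξ ^ 2)) * h) ^ 2 ≤
      (r ^ 2)⁻¹ * (Real.exp (-(2 * π ^ 2 * r ^ 2 * ξ ^ 2)) * h) ^ 2 + h ^ 2 := by
  set g := Real.exp (-(2 * π ^ 2 * r ^ 2 * ξ ^ 2)) with hg
  have h1 : |ξ| ≤ (r ^ 2)⁻¹ + r ^ 2 * ξ ^ 2 := by
    have h0 : 0 ≤ ((r⁻¹) - r * |ξ|) ^ 2 := sq_nonneg _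
    have e : ((r⁻¹) - r * |ξ|) ^ 2 = (r ^ 2)⁻¹ + r ^ 2 * ξ ^ 2 - 2 * |ξ| := by
      rw [sub_sq, mul_pow, sq_abs]; field_simp; ring
    have := abs_nonneg ξ
    linarith
  have h2 : r ^ 2 * ξ ^ 2 * g ^ 2 ≤ 1 := by
    have hy : 0 ≤ r ^ 2 * ξ ^ 2 := by positivity
    have a1 : g ^ 2 ≤ Real.exp (-(r ^ 2 * ξ ^ 2)) := by
      rw [hg, ← Real.exp_nat_mul]
      apply Real.exp_le_exp.2
      have : (1:ℝ) ≤ π ^ 2 := by nlinarith [Real.pi_gt_three]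
      push_cast
      nlinarith
    have a2 : r ^ 2 * ξ ^ 2 ≤ Real.exp (r ^ 2 * ξ ^ 2) := by
      linarith [Real.add_one_le_exp (r ^ 2 * ξ ^ 2)]
    calc r ^ 2 * ξ ^ 2 * g ^ 2 ≤ Real.exp (r ^ 2 * ξ ^ 2) * Real.exp (-(r ^ 2 * ξ ^ 2)) := by gcongr
      _ = 1 := by rw [← Real.exp_add]; simp
  calc |ξ| * (g * h) ^ 2 ≤ ((r ^ 2)⁻¹ + r ^ 2 * ξ ^ 2) * (g * h) ^ 2 := by gcongr
    _ = (r ^ 2)⁻¹ * (g * h) ^ 2 + (r ^ 2 * ξ ^ 2 * g ^ 2) * h ^ 2 := by ring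
    _ ≤ (r ^ 2)⁻¹ * (g * h) ^ 2 + 1 * h ^ 2 := by gcongr
    _ = _ := by ring

lemma aux_eLp (u : ℝ → ℝ) (p : ℝ≥0∞) : eLpNorm (fun x => (u x : ℂ)) p volume = eLpNorm u p volume := by
  apply eLpNorm_congr_norm_ae
  filter_upwards with x
  simp

lemma aux_H12 (r : ℝ) (hr : 0 < r) (f : ℝ → ℝ) (hf : Integrable f) :
    H12e (conv (gaussSc r) f) ≤
      ENNReal.ofReal ((r ^ 2)⁻¹) * eLpNorm (conv (gaussSc r) f) 2 volume ^ 2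
        + eLpNorm f 2 volume ^ 2 := by
  have hγ := aux_gauss_int r hr
  have hc := aux_conv_int hγ hf
  calc H12e (conv (gaussSc r) f)
      ≤ ∫⁻ ξ, (ENNReal.ofReal ((r ^ 2)⁻¹) * ‖𝓕 (fun x => (conv (gaussSc r) f x : ℂ)) ξ‖ₑ ^ 2
          + ‖𝓕 (fun x => (f x : ℂ)) ξ‖ₑ ^ 2) := by
        apply lintegral_mono
        intro ξ
        change ‖ξ‖ₑ * ‖𝓕 (fun x => (conv (gaussSc r) f x : ℂ)) ξ‖ₑ ^ 2 ≤ _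
        beta_reduce
        rw [aux_conv_ft hγ hf ξ, ← ofReal_norm, ← ofReal_norm, ← ofReal_norm,
          norm_mul, aux_gauss_ft r hr, ← ENNReal.ofReal_pow (by positivity), ← ENNReal.ofReal_pow (by positivity),
          ← ENNReal.ofReal_mul (by positivity), ← ENNReal.ofReal_mul (by positivity),
          ← ENNReal.ofReal_add (by positivity) (by positivity)]
        exact ENNReal.ofReal_le_ofReal (aux_real_ineq r hr ξ _)
    _ = ENNReal.ofReal ((r ^ 2)⁻¹) * (∫⁻ ξ, ‖𝓕 (fun x => (conv (gaussSc r) f x : ℂ)) ξ‖ₑ ^ 2)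
          + ∫⁻ ξ, ‖𝓕 (fun x => (f x : ℂ)) ξ‖ₑ ^ 2 := by
        have m1 : Measurable (fun ξ => ‖𝓕 (fun x => (conv (gaussSc r) f x : ℂ)) ξ‖ₑ ^ 2) :=
          ((aux_ft_cont hc).measurable.enorm).pow_const 2
        rw [lintegral_add_left (m1.const_mul _), lintegral_const_mul _ m1]
    _ ≤ _ := by
        gcongr
        · exact (aux_planch_s3 _ hc).trans_eq (by rw [aux_eLp])
        · exact (aux_planch_s3 _ hf.ofReal).trans_eq (congrArg (· ^ 2) (aux_eLp f 2))

lemma aux_conv_sub (r : ℝ) (hr : 0 < r) (f g : ℝ → ℝ) (hf : Measurable f) (hg : Measurable g)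
    (hf1 : ∀ x, |f x| ≤ 1) (hg1 : ∀ x, |g x| ≤ 1) (x : ℝ) :
    conv (gaussSc r) (fun y => f y - g y) x = conv (gaussSc r) f x - conv (gaussSc r) g x := by
  have hγ := aux_gauss_int r hr
  have key : ∀ f : ℝ → ℝ, Measurable f → (∀ x, |f x| ≤ 1) →
      Integrable (fun y => gaussSc r y * f (x - y)) := fun f hf hf1 =>
    hγ.mul_bdd (c := 1) (hf.comp (measurable_const.sub measurable_id)).aestronglyMeasurable
      (ae_of_all _ fun y => hf1 _)
  simp only [conv, mul_sub]
  exact integral_sub (key f hf hf1) (key g hg hg1)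

lemma aux_H12_sub (u v w : ℝ → ℝ) (hu : Integrable (fun x => (u x : ℂ)))
    (hv : Integrable (fun x => (v x : ℂ))) (h : ∀ x, w x = u x - v x) :
    H12e w ≤ 2 * H12e u + 2 * H12e v := by
  have e : ∀ ξ, 𝓕 (fun x => (w x : ℂ)) ξ = 𝓕 (fun x => (u x : ℂ)) ξ - 𝓕 (fun x => (v x : ℂ)) ξ := by
    intro ξ
    simp only [Real.fourier_eq, h, Complex.ofReal_sub, smul_sub]
    exact integral_sub ((Real.fourierIntegral_convergent_iff ξ).2 hu) ((Real.fourierIntegral_convergent_iff ξ).2 hv)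
  have m : ∀ u : ℝ → ℝ, Integrable (fun x => (u x : ℂ)) →
      Measurable (fun ξ => ‖ξ‖ₑ * ‖𝓕 (fun x => (u x : ℂ)) ξ‖ₑ ^ 2) := fun u hu =>
    measurable_enorm.mul (((aux_ft_cont hu).measurable.enorm).pow_const 2)
  calc H12e w ≤ ∫⁻ ξ, (2 * (‖ξ‖ₑ * ‖𝓕 (fun x => (u x : ℂ)) ξ‖ₑ ^ 2)
          + 2 * (‖ξ‖ₑ * ‖𝓕 (fun x => (v x : ℂ)) ξ‖ₑ ^ 2)) := by
        apply lintegral_mono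
        intro ξ
        change ‖ξ‖ₑ * ‖𝓕 (fun x => (w x : ℂ)) ξ‖ₑ ^ 2 ≤ _
        beta_reduce
        rw [e, ← ofReal_norm, ← ofReal_norm, ← ofReal_norm, ← ofReal_norm,
          ← ENNReal.ofReal_pow (by positivity), ← ENNReal.ofReal_pow (by positivity), ← ENNReal.ofReal_pow (by positivity),
          ← ENNReal.ofReal_mul (by positivity), ← ENNReal.ofReal_mul (by positivity), ← ENNReal.ofReal_mul (by positivity),
          ← ENNReal.ofReal_ofNat, ← ENNReal.ofReal_mul (by positivity), ← ENNReal.ofReal_mul (by positivity),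
          ← ENNReal.ofReal_add (by positivity) (by positivity)]
        apply ENNReal.ofReal_le_ofReal
        set a := 𝓕 (fun x => (u x : ℂ)) ξ
        set b := 𝓕 (fun x => (v x : ℂ)) ξ
        have h1 : ‖a - b‖ ^ 2 ≤ 2 * ‖a‖ ^ 2 + 2 * ‖b‖ ^ 2 := by
          have : ‖a - b‖ ≤ ‖a‖ + ‖b‖ := norm_sub_le a b
          have : ‖a - b‖ ^ 2 ≤ (‖a‖ + ‖b‖) ^ 2 := by gcongr
          nlinarith [sq_nonneg (‖a‖ - ‖b‖)]
        calc ‖ξ‖ * ‖a - b‖ ^ 2 ≤ ‖ξ‖ * (2 * ‖a‖ ^ 2 + 2 * ‖b‖ ^ 2) := by gcongr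
          _ = _ := by ring
    _ = _ := by
        rw [lintegral_add_left ((m u hu).const_mul _), lintegral_const_mul _ (m u hu), lintegral_const_mul _ (m v hv)]
        rfl

lemma aux_conv_lim (r : ℝ) (hr : 0 < r) (F : ℕ → ℝ → ℝ) (f : ℝ → ℝ) (hF : ∀ n, Measurable (F n))
    (hF1 : ∀ n x, |F n x| ≤ 1)
    (hlim : ∀ᵐ y, Tendsto (fun n => F n y) atTop (𝓝 (f y))) (x : ℝ) :
    Tendsto (fun n => conv (gaussSc r) (F n) x) atTop (𝓝 (conv (gaussSc r) f x)) := by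
  have hγ := aux_gauss_int r hr
  unfold conv
  refine tendsto_integral_of_dominated_convergence (fun y => ‖(gaussSc r y : ℝ)‖) ?_ hγ.norm ?_ ?_
  · intro n
    exact hγ.1.mul ((hF n).comp (measurable_const.sub measurable_id)).aestronglyMeasurable
  · intro n
    filter_upwards with y
    rw [norm_mul]
    exact mul_le_of_le_one_right (norm_nonneg _) (hF1 n _)
  · filter_upwards [(quasiMeasurePreserving_sub_left (volume : Measure ℝ) x).ae hlim] with y hy
    exact hy.const_mul _

lemma aux_tele (r : ℝ) (hr : 0 < r) (k : ℕ) (hk : 1 ≤ k) (φ : ℕ → ℝ → ℝ) (c : ℝ) (hc : 0 ≤ c)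
    (hm : ∀ k, 1 ≤ k → Measurable (φ k)) (hi : ∀ k, 1 ≤ k → Integrable (φ k))
    (h1 : ∀ k, 1 ≤ k → ∀ x, |φ k x| ≤ 1)
    (h : ∀ j, k ≤ j → eLpNorm (conv (gaussSc r) (fun y => φ j y - φ (j + 1) y)) 2 volume
      ≤ ENNReal.ofReal (c * (1 / 2) ^ j)) (m : ℕ) :
    eLpNorm (conv (gaussSc r) (fun y => φ k y - φ (k + m) y)) 2 volume
      ≤ ENNReal.ofReal (c * (2 - 2 * (1 / 2) ^ m)) := by
  have hγ := aux_gauss_int r hr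
  have hae : ∀ f : ℝ → ℝ, Integrable f → AEStronglyMeasurable (conv (gaussSc r) f) volume := by
    intro f hf
    have := Complex.continuous_re.comp_aestronglyMeasurable (aux_conv_int hγ hf).1
    simpa [Function.comp_def] using this
  induction m with
  | zero =>
    have : conv (gaussSc r) (fun y => φ k y - φ (k + 0) y) = 0 := by
      ext x; simp [conv]
    rw [this]; simp
  | succ m ih =>
    have e : conv (gaussSc r) (fun y => φ k y - φ (k + (m + 1)) y) =
        conv (gaussSc r) (fun y => φ k y - φ (k + m) y) +
        conv (gaussSc r) (fun y => φ (k + m) y - φ (k + m + 1) y) := by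
      ext x
      rw [Pi.add_apply, aux_conv_sub r hr _ _ (hm _ (by omega)) (hm _ (by omega)) (h1 _ (by omega)) (h1 _ (by omega)),
        aux_conv_sub r hr _ _ (hm _ (by omega)) (hm _ (by omega)) (h1 _ (by omega)) (h1 _ (by omega)),
        aux_conv_sub r hr _ _ (hm _ (by omega)) (hm _ (by omega)) (h1 _ (by omega)) (h1 _ (by omega)), add_assoc]
      ring
    rw [e]
    refine (eLpNorm_add_le (hae _ ((hi _ (by omega)).sub (hi _ (by omega))))
      (hae _ ((hi _ (by omega)).sub (hi _ (by omega)))) (by norm_num)).trans ?_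
    refine (add_le_add ih (h (k + m) (by omega))).trans ?_
    have hp : ((1:ℝ) / 2) ^ m ≤ 1 := pow_le_one₀ (by norm_num) (by norm_num)
    have hq : ((1:ℝ) / 2) ^ (k + m) ≤ (1 / 2) ^ m :=
      pow_le_pow_of_le_one (by norm_num) (by norm_num) (by omega)
    rw [← ENNReal.ofReal_add (mul_nonneg hc (by linarith)) (by positivity)]
    apply ENNReal.ofReal_le_ofReal
    rw [← mul_add]
    apply mul_le_mul_of_nonneg_left _ hc
    rw [pow_succ]
    linarith

/-- a compatible sequence `(φ_k)_{k≥1}` with scales `(ε_k)` converges to a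
measurable set `E ⊆ [0,1]` with `0 < |E| < 1`, in every `L^p` with `p < ∞`, and
`(1/|log ε_k|) ‖γ_{ε_k} ∗ 1_E‖_{H^{1/2}}² → 0`. -/
theorem compatible_sequence_limit (φ : ℕ → ℝ → ℝ) (ε : ℕ → ℝ)
    -- the φ_k are smooth and compactly supported in (0,1)
    (hφsm : ∀ k, 1 ≤ k → ContDiff ℝ (⊤ : ℕ∞) (φ k))
    (hφsupp : ∀ k, 1 ≤ k → HasCompactSupport (φ k) ∧ tsupport (φ k) ⊆ Set.Ioo 0 1)
    -- the scales are positive, strictly decreasing, and tend to 0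
    (hεpos : ∀ k, 1 ≤ k → 0 < ε k)
    (hεanti : ∀ k, 1 ≤ k → ε (k + 1) < ε k)
    (hεlim : Filter.Tendsto ε Filter.atTop (𝓝 0))
    -- nontriviality
    (hnontriv : 0 < volume {x : ℝ | φ 1 x = 1})
    -- convergence to a set
    (hrange : ∀ k, 1 ≤ k → ∀ x, 0 ≤ φ k x ∧ φ k x ≤ 1)
    (hsmall : ∀ k, 1 ≤ k →
      volume {x : ℝ | φ k x ≠ 0 ∧ φ k x ≠ 1} < ENNReal.ofReal ((0.99 : ℝ) ^ k))
    (hone : ∀ k, 1 ≤ k → {x : ℝ | φ k x = 1} ⊆ {x : ℝ | φ (k + 1) x = 1})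
    (hzero : ∀ k, 1 ≤ k → {x : ℝ | φ k x = 0} ⊆ {x : ℝ | φ (k + 1) x = 0})
    -- smoothness to scale ε_k
    (hsmooth : ∀ k, 1 ≤ k →
      ENNReal.ofReal |Real.log (ε k)|⁻¹ * H12e (conv (gaussSc (ε k)) (φ k))
        < ENNReal.ofReal ((2 : ℝ) ^ (-(k : ℝ))))
    -- compatibility across scales
    (hcompat : ∀ k, 1 ≤ k → ∀ r : ℝ, ε k ≤ r →
      eLpNorm (conv (gaussSc r) (fun y => φ k y - φ (k + 1) y)) 2 volume
        < ENNReal.ofReal (ε k ^ 3 * (2 : ℝ) ^ (-(k : ℝ)))) :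
    ∃ E : Set ℝ, MeasurableSet E ∧ E ⊆ Set.Icc 0 1 ∧ 0 < volume E ∧ volume E < 1 ∧
      (∀ p : ℝ, 1 ≤ p →
        Filter.Tendsto
          (fun k => eLpNorm (fun x => φ k x - E.indicator (fun _ => (1 : ℝ)) x)
            (ENNReal.ofReal p) volume) Filter.atTop (𝓝 0)) ∧
      Filter.Tendsto
        (fun k => ENNReal.ofReal |Real.log (ε k)|⁻¹ *
          H12e (conv (gaussSc (ε k)) (E.indicator fun _ => (1 : ℝ))))
        Filter.atTop (𝓝 0) := by
  classical
  have hone' : ∀ k, 1 ≤ k → ∀ m x, φ k x = 1 → φ (k + m) x = 1 := by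
    intro k hk m x h
    induction m with
    | zero => exact h
    | succ m ih => exact hone (k + m) (by omega) ih
  have hzero' : ∀ k, 1 ≤ k → ∀ m x, φ k x = 0 → φ (k + m) x = 0 := by
    intro k hk m x h
    induction m with
    | zero => exact h
    | succ m ih => exact hzero (k + m) (by omega) ih
  have hcont : ∀ k, 1 ≤ k → Continuous (φ k) := fun k hk => (hφsm k hk).continuous
  have hmeas : ∀ k, 1 ≤ k → Measurable (φ k) := fun k hk => (hcont k hk).measurable
  have hint : ∀ k, 1 ≤ k → Integrable (φ k) := fun k hk =>
    (hcont k hk).integrable_of_hasCompactSupport (hφsupp k hk).1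
  have habs : ∀ k, 1 ≤ k → ∀ x, |φ k x| ≤ 1 := fun k hk x => by
    rw [abs_of_nonneg (hrange k hk x).1]; exact (hrange k hk x).2
  obtain ⟨E, hE⟩ : ∃ E : Set ℝ, E = ⋃ k : ℕ, {x | φ (k + 1) x = 1} := ⟨_, rfl⟩
  have hEm : MeasurableSet E := by
    rw [hE]
    exact MeasurableSet.iUnion fun k => (hmeas (k + 1) (by omega)) (measurableSet_singleton 1)
  have hE1 : ∀ k, 1 ≤ k → ∀ x, φ k x = 1 → x ∈ E := by
    intro k hk x h
    rw [hE, Set.mem_iUnion]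
    exact ⟨k - 1, by simpa [Nat.sub_add_cancel hk] using h⟩
  have hE0 : ∀ k, 1 ≤ k → ∀ x, φ k x = 0 → x ∉ E := by
    intro k hk x h hx
    rw [hE, Set.mem_iUnion] at hx
    obtain ⟨j, hj⟩ := hx
    have a := hzero' k hk (j + 1) x h
    have b := hone' (j + 1) (by omega) k x hj
    rw [show j + 1 + k = k + (j + 1) by omega, a] at b
    norm_num at b
  have hEK : E ⊆ tsupport (φ 1) := by
    intro x hx
    apply subset_tsupport
    intro h
    exact hE0 1 le_rfl x h hx
  have hEpos : 0 < volume E :=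
    hnontriv.trans_le (measure_mono fun x hx => hE1 1 le_rfl x hx)
  have hElt : volume E < 1 := by
    have hK : IsCompact (tsupport (φ 1)) := (hφsupp 1 le_rfl).1
    have hne : (tsupport (φ 1)).Nonempty := by
      have : E.Nonempty := nonempty_of_measure_ne_zero hEpos.ne'
      exact this.mono hEK
    have ha := hK.sInf_mem hne
    have ha' := (hφsupp 1 le_rfl).2 ha
    have hsub : E ⊆ Set.Ioo (sInf (tsupport (φ 1)) / 2) 1 := by
      intro x hx
      refine ⟨?_, ((hφsupp 1 le_rfl).2 (hEK hx)).2⟩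
      have := csInf_le hK.bddBelow (hEK hx)
      linarith [ha'.1]
    refine (measure_mono hsub).trans_lt ?_
    rw [Real.volume_Ioo, ← ENNReal.ofReal_one]
    apply (ENNReal.ofReal_lt_ofReal_iff one_pos).2
    linarith [ha'.1]
  have hE01 : E ⊆ Set.Icc 0 1 := fun x hx =>
    Set.Ioo_subset_Icc_self ((hφsupp 1 le_rfl).2 (hEK hx))
  obtain ⟨χ, hχ⟩ : ∃ χ : ℝ → ℝ, χ = E.indicator (fun _ => (1 : ℝ)) := ⟨_, rfl⟩
  have hχr : ∀ x, 0 ≤ χ x ∧ χ x ≤ 1 := by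
    intro x
    rw [hχ]
    by_cases hx : x ∈ E <;> simp [hx]
  have hχm : Measurable χ := by rw [hχ]; exact measurable_const.indicator hEm
  have hχi : Integrable χ := by
    rw [hχ, integrable_indicator_iff hEm]
    exact integrableOn_const (hElt.trans ENNReal.one_lt_top).ne
  have hχabs : ∀ x, |χ x| ≤ 1 := fun x => by
    rw [abs_of_nonneg (hχr x).1]; exact (hχr x).2
  have hgood : ∀ k, 1 ≤ k → ∀ x, ¬ (φ k x ≠ 0 ∧ φ k x ≠ 1) → φ k x = χ x := by
    intro k hk x h
    rw [hχ]
    by_cases h0 : φ k x = 0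
    · simp [h0, hE0 k hk x h0]
    · have h1 : φ k x = 1 := by
        by_contra h1
        exact h ⟨h0, h1⟩
      simp [h1, hE1 k hk x h1]
  have hsubabs : ∀ k, 1 ≤ k → ∀ x, |φ k x - χ x| ≤ 1 := by
    intro k hk x
    rw [abs_le]
    constructor <;> linarith [(hχr x).1, (hχr x).2, (hrange k hk x).1, (hrange k hk x).2]
  obtain ⟨B, hB⟩ : ∃ B : ℕ → Set ℝ, B = fun k => {x : ℝ | φ k x ≠ 0 ∧ φ k x ≠ 1} := ⟨_, rfl⟩
  have hBm : ∀ k, 1 ≤ k → MeasurableSet (B k) := by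
    intro k hk
    rw [hB]
    exact ((hmeas k hk) (measurableSet_singleton 0)).compl.inter
      ((hmeas k hk) (measurableSet_singleton 1)).compl
  have hBlim : Tendsto (fun k => volume (B k)) atTop (𝓝 0) := by
    have h1 : Tendsto (fun k : ℕ => ENNReal.ofReal ((0.99 : ℝ) ^ k)) atTop (𝓝 0) := by
      have := ENNReal.tendsto_ofReal
        (tendsto_pow_atTop_nhds_zero_of_lt_one (r := (0.99 : ℝ)) (by norm_num) (by norm_num))
      simpa using this
    refine tendsto_of_tendsto_of_tendsto_of_le_of_le' tendsto_const_nhds h1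
      (Eventually.of_forall fun _ => zero_le) ?_
    filter_upwards [eventually_ge_atTop 1] with k hk
    rw [hB]
    exact (hsmall k hk).le
  have hLp : ∀ p : ℝ, 1 ≤ p → Tendsto (fun k => eLpNorm (fun x => φ k x - χ x)
      (ENNReal.ofReal p) volume) atTop (𝓝 0) := by
    intro p hp
    have hp0 : 0 < p := by linarith
    have h1 : Tendsto (fun k => volume (B k) ^ (1 / p)) atTop (𝓝 0) := by
      have := ((ENNReal.continuous_rpow_const (y := 1 / p)).tendsto 0).comp hBlim
      rwa [ENNReal.zero_rpow_of_pos (by positivity)] at this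
    refine tendsto_of_tendsto_of_tendsto_of_le_of_le' tendsto_const_nhds h1
      (Eventually.of_forall fun _ => zero_le) ?_
    filter_upwards [eventually_ge_atTop 1] with k hk
    calc eLpNorm (fun x => φ k x - χ x) (ENNReal.ofReal p) volume
        ≤ eLpNorm ((B k).indicator (fun _ => (1 : ℝ))) (ENNReal.ofReal p) volume := by
          apply eLpNorm_mono
          intro x
          by_cases hx : x ∈ B k
          · simpa [hx] using hsubabs k hk x
          · have : φ k x = χ x := hgood k hk x (by rw [hB] at hx; exact hx)
            simp [this]
      _ ≤ volume (B k) ^ (1 / p) := by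
          refine (eLpNorm_indicator_const_le (1 : ℝ) _).trans ?_
          simp [ENNReal.toReal_ofReal hp0.le]
  have hae : ∀ᵐ y, Tendsto (fun n => φ (n + 1) y) atTop (𝓝 (χ y)) := by
    have hnull : volume (⋂ k, B (k + 1)) = 0 := by
      refine le_antisymm ?_ zero_le
      exact ge_of_tendsto' ((tendsto_add_atTop_iff_nat 1).2 hBlim)
        fun k => measure_mono (Set.iInter_subset _ k)
    have : ∀ᵐ y, y ∉ ⋂ k, B (k + 1) := measure_eq_zero_iff_ae_notMem.1 hnull
    filter_upwards [this] with y hy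
    rw [Set.mem_iInter, not_forall] at hy
    obtain ⟨k, hk⟩ := hy
    rw [hB] at hk
    apply tendsto_const_nhds.congr'
    filter_upwards [eventually_ge_atTop k] with n hn
    obtain ⟨m, rfl⟩ := Nat.exists_eq_add_of_le hn
    have hk' : ¬ (φ (k + 1) y ≠ 0 ∧ φ (k + 1) y ≠ 1) := hk
    have hk2 := hgood (k + 1) (by omega) y hk'
    rw [← hk2, show k + m + 1 = k + 1 + m by omega]
    by_cases h0 : φ (k + 1) y = 0
    · rw [h0, hzero' (k + 1) (by omega) m y h0]
    · have h1 : φ (k + 1) y = 1 := by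
        by_contra h1
        exact hk' ⟨h0, h1⟩
      rw [h1, hone' (k + 1) (by omega) m y h1]
  have hεle : ∀ k, 1 ≤ k → ∀ m, ε (k + m) ≤ ε k := by
    intro k hk m
    induction m with
    | zero => exact le_rfl
    | succ m ih => exact (hεanti (k + m) (by omega)).le.trans ih
  have hL2 : ∀ k, 1 ≤ k → eLpNorm (conv (gaussSc (ε k)) (fun y => φ k y - χ y)) 2 volume
      ≤ ENNReal.ofReal (2 * ε k ^ 3) := by
    intro k hk
    have hr := hεpos k hk
    have htele := aux_tele (ε k) hr k hk φ (ε k ^ 3) (by positivity) hmeas hint habs (by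
      intro j hj
      obtain ⟨m, rfl⟩ := Nat.exists_eq_add_of_le hj
      refine (hcompat (k + m) (by omega) (ε k) (hεle k hk m)).le.trans ?_
      apply ENNReal.ofReal_le_ofReal
      have hp := hεpos (k + m) (by omega)
      have e : (2 : ℝ) ^ (-((k + m : ℕ) : ℝ)) = (1 / 2) ^ (k + m) := by
        rw [Real.rpow_neg (by norm_num), Real.rpow_natCast, one_div, inv_pow]
      rw [e]
      have := hεle k hk m
      gcongr)
    refine Lp.eLpNorm_le_of_ae_tendsto (u := atTop)
      (f := fun n : ℕ => conv (gaussSc (ε k)) (fun y => φ k y - φ (k + n) y)) ?_ ?_ ?_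
    · filter_upwards with n
      refine (htele n).trans (ENNReal.ofReal_le_ofReal ?_)
      have : (0:ℝ) ≤ (1 / 2) ^ n := by positivity
      nlinarith [pow_pos hr 3]
    · intro n
      have := Complex.continuous_re.comp_aestronglyMeasurable
        (aux_conv_int (aux_gauss_int _ hr) ((hint k hk).sub (hint (k + n) (by omega)))).1
      simp only [Function.comp_def, Complex.ofReal_re] at this
      exact this
    · filter_upwards with x
      apply aux_conv_lim (ε k) hr
      · intro n
        exact (hmeas k hk).sub (hmeas (k + n) (by omega))
      · intro n x
        rw [abs_le]
        have := hrange (k + n) (by omega) x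
        constructor <;> linarith [(hrange k hk x).1, (hrange k hk x).2]
      · filter_upwards [hae] with y hy
        apply Tendsto.const_sub
        have := (tendsto_add_atTop_iff_nat (k - 1)).2 hy
        refine this.congr fun n => ?_
        rw [show n + (k - 1) + 1 = k + n by omega]
  refine ⟨E, hEm, hE01, hEpos, hElt, ?_, ?_⟩
  · rw [← hχ]; exact hLp
  rw [← hχ]
  have hX : Tendsto (fun k : ℕ => 2 * ENNReal.ofReal ((2 : ℝ) ^ (-(k : ℝ))) +
      2 * (ENNReal.ofReal (4 * ε k ^ 4) + eLpNorm (fun x => φ k x - χ x)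
      (ENNReal.ofReal 2) volume ^ 2)) atTop (𝓝 0) := by
    have t1 : Tendsto (fun k : ℕ => ENNReal.ofReal ((2 : ℝ) ^ (-(k : ℝ)))) atTop (𝓝 0) := by
      have := ENNReal.tendsto_ofReal
        (tendsto_pow_atTop_nhds_zero_of_lt_one (r := ((1:ℝ)/2)) (by norm_num) (by norm_num))
      rw [ENNReal.ofReal_zero] at this
      refine this.congr fun k => ?_
      rw [Real.rpow_neg (by norm_num), Real.rpow_natCast, one_div, inv_pow]
    have t2 : Tendsto (fun k : ℕ => ENNReal.ofReal (4 * ε k ^ 4)) atTop (𝓝 0) := by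
      have := ENNReal.tendsto_ofReal ((hεlim.pow 4).const_mul 4)
      simpa using this
    have t3 := (ENNReal.continuous_pow 2).tendsto 0 |>.comp (hLp 2 (by norm_num))
    have c2 : (2 : ℝ≥0∞) ≠ ⊤ := by norm_num
    have := (ENNReal.Tendsto.const_mul (a := 2) t1 (Or.inr c2)).add
      (ENNReal.Tendsto.const_mul (a := 2) (t2.add t3) (Or.inr c2))
    simpa [Function.comp_def] using this
  refine tendsto_of_tendsto_of_tendsto_of_le_of_le' tendsto_const_nhds hX
      (Eventually.of_forall fun _ => zero_le) ?_
  have hεsmall : ∀ᶠ k in atTop, ε k < Real.exp (-1) :=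
    hεlim.eventually (gt_mem_nhds (Real.exp_pos _))
  filter_upwards [eventually_ge_atTop 1, hεsmall] with k hk hek
  have hr := hεpos k hk
  have hlog : |Real.log (ε k)|⁻¹ ≤ 1 := by
    apply inv_le_one_of_one_le₀
    have : Real.log (ε k) < -1 := by
      rw [Real.log_lt_iff_lt_exp hr]; exact hek
    rw [abs_of_neg (by linarith)]
    linarith
  have hγ := aux_gauss_int _ hr
  have hfi : Integrable (fun y => φ k y - χ y) := (hint k hk).sub hχi
  have h1 := aux_H12_sub (conv (gaussSc (ε k)) (φ k)) (conv (gaussSc (ε k)) (fun y => φ k y - χ y))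
    (conv (gaussSc (ε k)) χ) (aux_conv_int hγ (hint k hk)) (aux_conv_int hγ hfi) (by
      intro x
      rw [aux_conv_sub _ hr _ _ (hmeas k hk) hχm (habs k hk) hχabs]
      ring)
  have h2 : H12e (conv (gaussSc (ε k)) (fun y => φ k y - χ y)) ≤
      ENNReal.ofReal (4 * ε k ^ 4) + eLpNorm (fun x => φ k x - χ x) (ENNReal.ofReal 2) volume ^ 2 := by
    refine (aux_H12 _ hr _ hfi).trans ?_
    rw [ENNReal.ofReal_ofNat]
    gcongr
    calc _ ≤ ENNReal.ofReal ((ε k ^ 2)⁻¹) * ENNReal.ofReal (2 * ε k ^ 3) ^ 2 := by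
          gcongr
          exact hL2 k hk
      _ = _ := by
          rw [← ENNReal.ofReal_pow (by positivity), ← ENNReal.ofReal_mul (by positivity)]
          congr 1
          field_simp
          ring
  have hl1 : ENNReal.ofReal |Real.log (ε k)|⁻¹ ≤ 1 := by
    rw [← ENNReal.ofReal_one]; exact ENNReal.ofReal_le_ofReal hlog
  calc _ ≤ ENNReal.ofReal |Real.log (ε k)|⁻¹ * (2 * H12e (conv (gaussSc (ε k)) (φ k)) +
        2 * H12e (conv (gaussSc (ε k)) (fun y => φ k y - χ y))) := by gcongr
    _ = 2 * (ENNReal.ofReal |Real.log (ε k)|⁻¹ * H12e (conv (gaussSc (ε k)) (φ k))) +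
        2 * (ENNReal.ofReal |Real.log (ε k)|⁻¹ *
          H12e (conv (gaussSc (ε k)) (fun y => φ k y - χ y))) := by ring
    _ ≤ _ := by
        refine add_le_add (mul_le_mul_right (hsmooth k hk).le _) (mul_le_mul_right ?_ _)
        exact (mul_le_mul_left hl1 _).trans (by rw [one_mul]; exact h2)
end
end
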